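/- Let F be a discretely valued Henselian field with perfect residue field, l a nonnegative integer, and E/F a separable algebraic extension. Then E/F is at most l-ramified (i.e., for every finite subextension E∘/F of E/F the relation Ξ^l on Hom_{F-alg}(E∘, F^sep) is the equality relation) if and only if the upper ramification subgroup I_F^l of Γ_F fixes any (equivalently, every) F-algebra embedding E ↪ F^sep, i.e., γ ∘ ι = ι for all γ ∈ I_F^l and any F-algebra embedding ι : E → F^sep. -/

import Mathlib

noncomputable section

open scoped Classical

/-- An additive `ℝ ∪ {⊤}`-valued valuation on a field `Ω`. -/
structure AddVal (Ω : Type*) [Field Ω] where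
  v : Ω → WithTop ℝ
  v_zero : v 0 = ⊤
  v_ne_top : ∀ x : Ω, x ≠ 0 → v x ≠ ⊤
  v_mul : ∀ x y : Ω, v (x * y) = v x + v y
  v_min_le_add : ∀ x y : Ω, min (v x) (v y) ≤ v (x + y)

namespace AddVal

variable {Ω : Type*} [Field Ω]

/-- `V` is normalized on `F`: its value group on `F^×` is exactly `ℤ`.
This encodes that `F` is a discretely valued field and `V` extends the
normalized discrete valuation `val_F` of `F`. -/
def IsNormalizedOn (V : AddVal Ω) (F : Type*) [Field F] [Algebra F Ω] : Prop :=
  (∀ x : F, x ≠ 0 → ∃ k : ℤ, V.v (algebraMap F Ω x) = ((k : ℝ) : WithTop ℝ)) ∧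
    (∃ x : F, V.v (algebraMap F Ω x) = ((1 : ℝ) : WithTop ℝ))

/-- Henselian property of the valued field `(F, val_F)` (simple-root Hensel lemma). -/
def IsHenselianOn (V : AddVal Ω) (F : Type*) [Field F] [Algebra F Ω] : Prop :=
  ∀ f : Polynomial F,
    (∀ i : ℕ, 0 ≤ V.v (algebraMap F Ω (f.coeff i))) →
      ∀ a₀ : F, 0 ≤ V.v (algebraMap F Ω a₀) →
        0 < V.v (algebraMap F Ω (Polynomial.eval a₀ f)) →
        V.v (algebraMap F Ω (Polynomial.eval a₀ (Polynomial.derivative f))) = 0 →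
        ∃ a : F, Polynomial.eval a f = 0 ∧ 0 < V.v (algebraMap F Ω (a - a₀))

/-- The residue field of `(F, val_F)` is perfect: in positive residue characteristic `p`,
the Frobenius is surjective on the residue field. -/
def HasPerfectResidueFieldOn (V : AddVal Ω) (F : Type*) [Field F] [Algebra F Ω] : Prop :=
  ∀ p : ℕ, p.Prime → 0 < V.v (algebraMap F Ω (p : F)) →
    ∀ x : F, 0 ≤ V.v (algebraMap F Ω x) →
      ∃ y : F, 0 ≤ V.v (algebraMap F Ω y) ∧ 0 < V.v (algebraMap F Ω (x - y ^ p))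

/-- `e` is the (absolute) ramification index of `E` over the field on which `V` is
normalized: the value group of `E^×` is exactly `(1/e)ℤ`.  In particular `E` is
finitely ramified. -/
def IsRamIdx (V : AddVal Ω) {K : Type*} [Field K] [Algebra K Ω]
    (E : IntermediateField K Ω) (e : ℕ) : Prop :=
  0 < e ∧
    (∀ x : ↥E, x ≠ 0 → ∃ k : ℤ, V.v (x : Ω) = ((((k : ℝ) / (e : ℝ) : ℝ)) : WithTop ℝ)) ∧
    (∃ x : ↥E, V.v (x : Ω) = (((1 / (e : ℝ) : ℝ)) : WithTop ℝ))

end AddVal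

/-- The lower ramification relation `Ξ_r` on `K`-algebra embeddings of `E` into `Ω`,
where `e` is the absolute ramification index of `E` (over the normalization field of `V`):
`σ Ξ_r τ` iff `val_M (σ x - τ x) ≥ e(M/E) (r+1)` for all integral `x` and any (equivalently
some) suitable Galois `M`; this is equivalent to `V.v (σ x - τ x) ≥ (r+1)/e` for all
integral `x`. -/
def xiRel {Ω : Type*} [Field Ω] (V : AddVal Ω) {K : Type*} [Field K] [Algebra K Ω]
    (E : IntermediateField K Ω) (e : ℕ) (r : ℝ) (σ τ : ↥E →ₐ[K] Ω) : Prop :=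
  ∀ x : ↥E, 0 ≤ V.v (x : Ω) →
    ((((r + 1) / (e : ℝ) : ℝ)) : WithTop ℝ) ≤ V.v (σ x - τ x)

/-- `g_t`: the (common) cardinality of a `Ξ_t`-equivalence class, realized as the
cardinality of the class of the inclusion `E ↪ Ω`. -/
def gfun {Ω : Type*} [Field Ω] (V : AddVal Ω) {K : Type*} [Field K] [Algebra K Ω]
    (E : IntermediateField K Ω) (e : ℕ) (t : ℝ) : ℕ :=
  Nat.card {σ : ↥E →ₐ[K] Ω // xiRel V E e t σ E.val}

/-- The Herbrand function `φ_{E/K}(r) = ∫_0^r (g_t / g_0) dt`. -/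
def herbrand {Ω : Type*} [Field Ω] (V : AddVal Ω) {K : Type*} [Field K] [Algebra K Ω]
    (E : IntermediateField K Ω) (e : ℕ) (r : ℝ) : ℝ :=
  ∫ t in (0:ℝ)..r, ((gfun V E e t : ℝ) / (gfun V E e 0 : ℝ))

/-- `E/K` is at most `l`-ramified: for every finite subextension `E₀/K` the relation
`Ξ^l = Ξ_{ψ_{E₀/K}(l)}` is trivial. -/
def atMostRamified {Ω : Type*} [Field Ω] (V : AddVal Ω) {K : Type*} [Field K] [Algebra K Ω]
    (E : IntermediateField K Ω) (l : ℝ) : Prop :=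
  ∀ E₀ : IntermediateField K Ω, E₀ ≤ E → FiniteDimensional K ↥E₀ →
    ∀ (e₀ : ℕ) (s : ℝ), V.IsRamIdx E₀ e₀ → 0 ≤ s → herbrand V E₀ e₀ s = l →
      ∀ σ τ : ↥E₀ →ₐ[K] Ω, xiRel V E₀ e₀ s σ τ → σ = τ

/-- Membership of `γ ∈ Γ_K` in the upper ramification subgroup `I_K^l`: for every
finite Galois subextension `M/K` (with ramification index `eM` and `ψ_{M/K}(l) = sM`),
the image of `γ` in `Gal(M/K)` lies in `Gal(M/K)^l = Gal(M/K)_{ψ_{M/K}(l)}`. -/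
def inUpperRam {Ω : Type*} [Field Ω] (V : AddVal Ω) {K : Type*} [Field K] [Algebra K Ω]
    (l : ℝ) (γ : Ω ≃ₐ[K] Ω) : Prop :=
  ∀ (M : IntermediateField K Ω) (eM : ℕ) (sM : ℝ),
    FiniteDimensional K ↥M → IsGalois K ↥M → V.IsRamIdx M eM → 0 ≤ sM →
      herbrand V M eM sM = l →
      xiRel V M eM sM (γ.toAlgHom.comp M.val) M.val

namespace AddVal

section Basic

variable {Ω : Type*} [Field Ω] (V : AddVal Ω)

lemma v_one : V.v 1 = 0 := by
  have h := V.v_mul 1 1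
  obtain ⟨a, ha⟩ := WithTop.ne_top_iff_exists.mp (V.v_ne_top 1 one_ne_zero)
  rw [mul_one, ← ha] at h
  rw [← ha]
  norm_cast at h ⊢
  linarith

/-- The valuation as a bundled `AddValuation`. -/
def toAddValuation : AddValuation Ω (WithTop ℝ) :=
  AddValuation.of V.v V.v_zero V.v_one V.v_min_le_add V.v_mul

@[simp]
lemma toAddValuation_apply (x : Ω) : V.toAddValuation x = V.v x := rfl

lemma v_eq_top_iff {x : Ω} : V.v x = ⊤ ↔ x = 0 :=
  ⟨fun h => by_contra fun hx => V.v_ne_top x hx h, fun h => h ▸ V.v_zero⟩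

lemma exists_real {x : Ω} (hx : x ≠ 0) : ∃ a : ℝ, V.v x = (a : WithTop ℝ) := by
  obtain ⟨a, ha⟩ := WithTop.ne_top_iff_exists.mp (V.v_ne_top x hx)
  exact ⟨a, ha.symm⟩

lemma v_neg (x : Ω) : V.v (-x) = V.v x := V.toAddValuation.map_neg x

lemma v_sub_comm (x y : Ω) : V.v (x - y) = V.v (y - x) := by
  rw [← V.v_neg, neg_sub]

lemma le_v_add {x y : Ω} {a : WithTop ℝ} (hx : a ≤ V.v x) (hy : a ≤ V.v y) :
    a ≤ V.v (x + y) := (le_min hx hy).trans (V.v_min_le_add x y)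

lemma le_v_sub {x y : Ω} {a : WithTop ℝ} (hx : a ≤ V.v x) (hy : a ≤ V.v y) :
    a ≤ V.v (x - y) := by
  rw [sub_eq_add_neg]
  exact V.le_v_add hx (by rwa [V.v_neg])

lemma lt_v_sub {x y : Ω} {a : WithTop ℝ} (hx : a < V.v x) (hy : a < V.v y) :
    a < V.v (x - y) := by
  rw [sub_eq_add_neg]
  exact (lt_min hx (by rwa [V.v_neg])).trans_le (V.v_min_le_add _ _)

lemma v_add_eq_left {x y : Ω} (h : V.v x < V.v y) : V.v (x + y) = V.v x := by
  rw [add_comm]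
  exact V.toAddValuation.map_add_eq_of_lt_right h

lemma v_pow (x : Ω) (n : ℕ) : V.v (x ^ n) = n • V.v x := V.toAddValuation.map_pow x n

lemma v_prod {ι : Type*} (s : Finset ι) (f : ι → Ω) :
    V.v (∏ i ∈ s, f i) = ∑ i ∈ s, V.v (f i) := by
  induction s using Finset.induction_on with
  | empty => simpa using V.v_one
  | insert a s ha ih => rw [Finset.prod_insert ha, Finset.sum_insert ha, V.v_mul, ih]

lemma v_eq_zero_of_sub_one {x : Ω} (h : 0 < V.v (x - 1)) : V.v x = 0 := by
  have := V.v_add_eq_left (x := 1) (y := x - 1) (by rwa [V.v_one])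
  rwa [add_sub_cancel, V.v_one] at this

lemma v_inv_eq {x : Ω} (hx : x ≠ 0) {a : ℝ} (ha : V.v x = (a : WithTop ℝ)) :
    V.v x⁻¹ = ((-a : ℝ) : WithTop ℝ) := by
  obtain ⟨b, hb⟩ := V.exists_real (inv_ne_zero hx)
  have h := V.v_mul x x⁻¹
  rw [mul_inv_cancel₀ hx, V.v_one, ha, hb] at h
  rw [hb]
  norm_cast at h ⊢
  linarith

/-- The valuation ring of `V`, as a subring of `Ω`. -/
def integers : Subring Ω where
  carrier := {x | 0 ≤ V.v x}
  mul_mem' {x y} hx hy := by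
    simp only [Set.mem_ofPred_eq] at *
    rw [V.v_mul]
    exact add_nonneg hx hy
  one_mem' := V.v_one.ge
  add_mem' hx hy := V.le_v_add hx hy
  zero_mem' := by simp [V.v_zero]
  neg_mem' {x} hx := by simpa only [Set.mem_ofPred_eq, V.v_neg] using hx

lemma mem_integers {x : Ω} : x ∈ V.integers ↔ 0 ≤ V.v x := Iff.rfl

lemma v_eval_nonneg {P : Polynomial Ω} (hP : ∀ i, 0 ≤ V.v (P.coeff i)) {x : Ω}
    (hx : 0 ≤ V.v x) : 0 ≤ V.v (P.eval x) := by
  rw [Polynomial.eval_eq_sum_range, ← V.mem_integers]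
  exact sum_mem fun i _ => mul_mem (hP i) (pow_mem (V.mem_integers.mpr hx) i)

lemma v_coeff_prod_X_sub_C (s : Multiset Ω) (hs : ∀ x ∈ s, 0 ≤ V.v x) (i : ℕ) :
    0 ≤ V.v ((s.map fun x => Polynomial.X - Polynomial.C x).prod.coeff i) := by
  have h : (s.map fun x => Polynomial.X - Polynomial.C x).prod ∈
      Polynomial.lifts V.integers.subtype := by
    refine multiset_prod_mem _ fun p hp => ?_
    obtain ⟨x, hx, rfl⟩ := Multiset.mem_map.mp hp
    exact ⟨Polynomial.X - Polynomial.C ⟨x, hs x hx⟩, by simp⟩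
  rw [Polynomial.lifts_iff_coeff_lifts] at h
  obtain ⟨y, hy⟩ := h i
  rw [← hy]
  exact y.2

/-- The absolute value `exp (-v)`. -/
def absVal : AbsoluteValue Ω ℝ where
  toFun x := if x = 0 then 0 else Real.exp (-(V.v x).untopD 0)
  map_mul' x y := by
    by_cases hx : x = 0
    · simp [hx]
    by_cases hy : y = 0
    · simp [hy]
    obtain ⟨a, ha⟩ := V.exists_real hx
    obtain ⟨b, hb⟩ := V.exists_real hy
    simp only [mul_eq_zero, hx, hy, or_self, if_false, V.v_mul, ha, hb, ← WithTop.coe_add,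
      WithTop.untopD_coe, ← Real.exp_add]
    ring_nf
  nonneg' x := by
    split_ifs
    exacts [le_rfl, (Real.exp_pos _).le]
  eq_zero' x := by
    split_ifs with h
    · simp [h]
    · simp [h, Real.exp_ne_zero]
  add_le' x y := by
    by_cases hx : x = 0
    · simp [hx]
    by_cases hy : y = 0
    · simp [hy]
    by_cases hxy : x + y = 0
    · simp only [hxy, hx, hy, if_true, if_false]
      positivity
    obtain ⟨a, ha⟩ := V.exists_real hx
    obtain ⟨b, hb⟩ := V.exists_real hy
    obtain ⟨c, hc⟩ := V.exists_real hxy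
    have h := V.v_min_le_add x y
    simp only [hx, hy, hxy, if_false, ha, hb, hc, WithTop.untopD_coe] at h ⊢
    rcases min_le_iff.mp h with h | h
    · have h1 : Real.exp (-c) ≤ Real.exp (-a) :=
        Real.exp_le_exp.mpr (neg_le_neg (WithTop.coe_le_coe.mp h))
      linarith [Real.exp_pos (-b)]
    · have h1 : Real.exp (-c) ≤ Real.exp (-b) :=
        Real.exp_le_exp.mpr (neg_le_neg (WithTop.coe_le_coe.mp h))
      linarith [Real.exp_pos (-a)]

lemma absVal_of_v {x : Ω} {a : ℝ} (h : V.v x = (a : WithTop ℝ)) :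
    V.absVal x = Real.exp (-a) := by
  have hx : x ≠ 0 := by
    rintro rfl
    rw [V.v_zero] at h
    exact WithTop.top_ne_coe h
  change (if x = 0 then 0 else Real.exp (-(V.v x).untopD 0)) = _
  rw [if_neg hx, h, WithTop.untopD_coe]

lemma absVal_lt_one {x : Ω} : V.absVal x < 1 ↔ 0 < V.v x := by
  by_cases hx : x = 0
  · simp [hx, V.v_zero]
  obtain ⟨a, ha⟩ := V.exists_real hx
  rw [V.absVal_of_v ha, ha, Real.exp_lt_one_iff]
  norm_cast
  simp

lemma one_lt_absVal {x : Ω} : 1 < V.absVal x ↔ V.v x < 0 := by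
  by_cases hx : x = 0
  · simp [hx, V.v_zero]
  obtain ⟨a, ha⟩ := V.exists_real hx
  rw [V.absVal_of_v ha, ha, Real.one_lt_exp_iff]
  norm_cast
  simp

lemma v_eq_of_absVal_eq {x y : Ω} (h : V.absVal x = V.absVal y) : V.v x = V.v y := by
  by_cases hx : x = 0
  · have : y = 0 := by
      rw [hx, map_zero] at h
      exact V.absVal.eq_zero.mp h.symm
    rw [hx, this]
  have hy : y ≠ 0 := by
    rintro rfl
    exact hx (by simpa using h)
  obtain ⟨a, ha⟩ := V.exists_real hx
  obtain ⟨b, hb⟩ := V.exists_real hy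
  rw [V.absVal_of_v ha, V.absVal_of_v hb, Real.exp_eq_exp, neg_inj] at h
  rw [ha, hb, h]

end Basic
end AddVal

namespace AddVal
section Invariance

/-- Restriction of a valuation along a field homomorphism. -/
def comap {L Ω : Type*} [Field L] [Field Ω] (W : AddVal Ω) (f : L →+* Ω) : AddVal L where
  v x := W.v (f x)
  v_zero := by rw [map_zero, W.v_zero]
  v_ne_top x hx := W.v_ne_top _ (by simpa using hx)
  v_mul x y := by rw [map_mul, W.v_mul]
  v_min_le_add x y := by rw [map_add]; exact W.v_min_le_add _ _

@[simp] lemma comap_v {L Ω : Type*} [Field L] [Field Ω] (W : AddVal Ω) (f : L →+* Ω) (x : L) :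
    (W.comap f).v x = W.v (f x) := rfl

variable {F M : Type*} [Field F] [Field M] [Algebra F M]

/-- Independence of the finitely many conjugates of `W`: an element close to `1` for `W`, and close
to `0` for all conjugates of `W` that differ from `W`. -/
lemma exists_separating [FiniteDimensional F M] (W : AddVal M) (hnorm : W.IsNormalizedOn F) :
    ∃ b : M, 0 < W.v (b - 1) ∧
      ∀ g : M ≃ₐ[F] M, (¬ ∀ y, W.v (g y) = W.v y) → 0 < W.v (g b) := by
  obtain ⟨ϖ, hϖ⟩ := hnorm.2
  let w : (M ≃ₐ[F] M) → AbsoluteValue M ℝ := fun g => (W.comap (g : M →+* M)).absVal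
  have hw : ∀ g, w g (algebraMap F M ϖ) = Real.exp (-1) := fun g =>
    absVal_of_v _ (by simpa using hϖ)
  let ι := Set.range w
  let vv : ι → AbsoluteValue M ℝ := Subtype.val
  have hne : ∀ i, (vv i).IsNontrivial := by
    rintro ⟨_, g, rfl⟩
    refine ⟨algebraMap F M ϖ, ?_, ?_⟩
    · intro h0
      rw [h0, W.v_zero] at hϖ
      exact WithTop.top_ne_coe hϖ
    · change w g _ ≠ 1
      rw [hw]
      simp
  have hpair : Pairwise fun i j => ¬ (vv i).IsEquiv (vv j) := by
    rintro ⟨_, g, rfl⟩ ⟨_, g', rfl⟩ hij hE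
    apply hij
    change (w g).IsEquiv (w g') at hE
    obtain ⟨c, hc, h⟩ := AbsoluteValue.isEquiv_iff_exists_rpow_eq.mp hE
    have h1 := congrFun h (algebraMap F M ϖ)
    simp only [hw] at h1
    rw [← Real.exp_mul, Real.exp_eq_exp] at h1
    have hc1 : c = 1 := by linarith
    apply Subtype.ext
    ext x
    have := congrFun h x
    simpa [hc1] using this
  obtain ⟨a, ha, ha'⟩ := AbsoluteValue.exists_one_lt_lt_one_pi_of_not_isEquiv hne hpair
    ⟨w 1, 1, rfl⟩
  have hWa : W.v a < 0 := (one_lt_absVal _).mp ha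
  have hga : ∀ g : M ≃ₐ[F] M, (¬ ∀ y, W.v (g y) = W.v y) → 0 < W.v (g a) := by
    intro g hg
    refine (absVal_lt_one (W.comap (g : M →+* M))).mp (ha' ⟨w g, g, rfl⟩ ?_)
    intro h
    apply hg
    intro y
    have h1 : w g = w 1 := congrArg Subtype.val h
    have h2 : w g y = w 1 y := by rw [h1]
    change (W.comap (g : M →+* M)).absVal y = (W.comap ((1 : M ≃ₐ[F] M) : M →+* M)).absVal y at h2
    have key : ∀ z : M, (W.comap ((1 : M ≃ₐ[F] M) : M →+* M)).absVal z = W.absVal z := fun z => rfl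
    have key2 : ∀ z : M, (W.comap (g : M →+* M)).absVal z = W.absVal (g z) := by
      intro z
      by_cases hz : z = 0
      · simp [hz]
      obtain ⟨r, hr⟩ := W.exists_real (x := g z) (by simpa using hz)
      rw [absVal_of_v (W.comap (g : M →+* M)) (a := r) hr, W.absVal_of_v hr]
    rw [key, key2] at h2
    exact W.v_eq_of_absVal_eq h2
  have h1a : W.v (1 + a) = W.v a := by
    rw [add_comm]
    exact W.v_add_eq_left (by rwa [W.v_one])
  have hane : a ≠ 0 := by
    rintro rfl
    rw [W.v_zero] at hWa
    exact absurd hWa (by simp)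
  obtain ⟨r, hr⟩ := W.exists_real hane
  have hr0 : r < 0 := by rw [hr] at hWa; exact_mod_cast hWa
  have h1ane : 1 + a ≠ 0 := by
    intro h
    rw [h, W.v_zero, hr] at h1a
    exact WithTop.top_ne_coe h1a
  refine ⟨a * (1 + a)⁻¹, ?_, ?_⟩
  · have : a * (1 + a)⁻¹ - 1 = -(1 + a)⁻¹ := by field_simp; ring
    rw [this, W.v_neg, W.v_inv_eq h1ane (h1a.trans hr)]
    exact_mod_cast neg_pos.mpr hr0
  · intro g hg
    have h := hga g hg
    have h1 : W.v (1 + g a) = 0 := W.v_eq_zero_of_sub_one (by simpa using h)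
    have h1' : W.v (1 + g a)⁻¹ = 0 := by
      have := W.v_inv_eq (x := 1 + g a) (a := 0) (by
        intro h0
        rw [h0, W.v_zero] at h1
        exact absurd h1 (by simp)) (by simpa using h1)
      simpa using this
    rw [map_mul, map_inv₀, map_add, map_one, W.v_mul, h1', add_zero]
    exact h

lemma v_sub_one_prod (W : AddVal M) {ι : Type*} (s : Finset ι) (f : ι → M)
    (h : ∀ i ∈ s, 0 < W.v (f i - 1)) : 0 < W.v (∏ i ∈ s, f i - 1) := by
  induction s using Finset.induction_on with
  | empty => simp [W.v_zero]
  | insert i s hi ih =>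
    have h1 := ih fun j hj => h j (Finset.mem_insert_of_mem hj)
    have h2 := h i (Finset.mem_insert_self i s)
    rw [Finset.prod_insert hi]
    have : f i * ∏ x ∈ s, f x - 1 = f i * (∏ x ∈ s, f x - 1) - (1 - f i) := by ring
    rw [this]
    apply W.lt_v_sub
    · rw [W.v_mul, W.v_eq_zero_of_sub_one h2, zero_add]
      exact h1
    · rwa [W.v_sub_comm]

open Polynomial in
/-- A discrete Henselian valuation has a unique extension: it is Galois invariant. -/
theorem v_algEquiv_of_finite [FiniteDimensional F M] [IsGalois F M] (W : AddVal M)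
    (hnorm : W.IsNormalizedOn F) (hhens : W.IsHenselianOn F) (g : M ≃ₐ[F] M) (x : M) :
    W.v (g x) = W.v x := by
  by_contra hgx
  have hg0 : ¬ ∀ y, W.v (g y) = W.v y := fun h => hgx (h x)
  obtain ⟨b, hb1, hb⟩ := exists_separating (F := F) W hnorm
  let D : Finset (M ≃ₐ[F] M) := Finset.univ.filter fun d => ∀ y, W.v (d y) = W.v y
  have hD : ∀ d, d ∈ D ↔ ∀ y, W.v (d y) = W.v y := fun d => by simp [D]
  set c : M := ∏ d ∈ D, d b with hc
  have hc1 : 0 < W.v (c - 1) := by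
    refine W.v_sub_one_prod _ _ fun d hd => ?_
    have : d b - 1 = d (b - 1) := by simp
    rw [this, (hD d).mp hd]
    exact hb1
  have hc0 : W.v c = 0 := W.v_eq_zero_of_sub_one hc1
  have hDc : ∀ d ∈ D, d c = c := by
    intro d hd
    rw [hc, map_prod]
    refine Finset.prod_bij (fun e _ => d * e) ?_ ?_ ?_ ?_
    · intro e he
      rw [hD] at *
      intro y
      rw [AlgEquiv.mul_apply, hd, he]
    · intro e _ e' _ h
      exact mul_left_cancel h
    · intro e he
      refine ⟨d⁻¹ * e, ?_, by simp⟩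
      rw [hD] at *
      intro y
      rw [AlgEquiv.mul_apply, ← hd (d⁻¹ (e y)), ← AlgEquiv.mul_apply, mul_inv_cancel,
        AlgEquiv.one_apply, he]
    · intro e _
      rfl
  have hcg : ∀ h : M ≃ₐ[F] M, h ∉ D → 0 < W.v (h c) := by
    intro h hh
    rw [hc, map_prod, W.v_prod]
    have h0 : ∀ d ∈ D, 0 < W.v (h (d b)) := by
      intro d hd
      have := hb (h * d) (by
        rw [← hD]
        rw [hD] at *
        intro hhd
        apply hh
        intro y
        have := hhd (d⁻¹ y)
        rw [AlgEquiv.mul_apply, ← AlgEquiv.mul_apply d, mul_inv_cancel, AlgEquiv.one_apply] at this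
        rw [this, ← hd (d⁻¹ y), ← AlgEquiv.mul_apply, mul_inv_cancel, AlgEquiv.one_apply])
      simpa using this
    have h1D : (1 : M ≃ₐ[F] M) ∈ D := (hD _).mpr fun y => rfl
    exact lt_of_lt_of_le (h0 1 h1D)
      (Finset.single_le_sum (f := fun d => W.v (h (d b))) (fun d hd => (h0 d hd).le) h1D)
  have hint : IsIntegral F c := Algebra.IsIntegral.isIntegral c
  set f := minpoly F c with hf
  set R : Multiset M := (f.map (algebraMap F M)).roots with hR
  have hsplit := (Normal.splits (inferInstance : Normal F M) c).eq_prod_roots_of_monic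
    ((minpoly.monic hint).map _)
  have hRmem : ∀ r ∈ R, ∃ h : M ≃ₐ[F] M, h c = r := by
    intro r hr
    have : IsConjRoot F c r := (isConjRoot_iff_mem_minpoly_aroots hint).mpr hr
    exact isConjRoot_iff_exists_algEquiv.mp this.symm
  have hRc : c ∈ R := (isConjRoot_iff_mem_minpoly_aroots hint).mp (IsConjRoot.refl)
  have hnodup : R.Nodup := by
    refine nodup_roots ?_
    exact (show (minpoly F c).Separable from Algebra.IsSeparable.isSeparable F c).map
  set R' := R.erase c with hR'
  have hR'pos : ∀ r ∈ R', 0 < W.v r := by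
    intro r hr
    obtain ⟨hrc, hrR⟩ := hnodup.mem_erase_iff.mp hr
    obtain ⟨h, rfl⟩ := hRmem r hrR
    exact hcg h fun hh => hrc (hDc h hh)
  set q : M[X] := (R'.map fun r => X - C r).prod with hq
  have hfq : f.map (algebraMap F M) = (X - C c) * q := by
    rw [hsplit]
    exact (Multiset.prod_map_erase (f := fun r : M => X - C r) hRc).symm
  have hRnonneg : ∀ r ∈ R, 0 ≤ W.v r := by
    intro r hr
    by_cases hrc : r = c
    · rw [hrc, hc0]
    · exact (hR'pos r (hnodup.mem_erase_iff.mpr ⟨hrc, hr⟩)).le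
  have hq1 : W.v (q.eval 1) = 0 := by
    have hgen : ∀ s : Multiset M, (∀ r ∈ s, 0 < W.v r) →
        W.v ((s.map fun r => X - C r).prod.eval 1) = 0 := by
      intro s
      induction s using Multiset.induction_on with
      | empty => intro _; simp [W.v_one]
      | cons r s ih =>
        intro hs
        rw [Multiset.map_cons, Multiset.prod_cons, eval_mul, W.v_mul,
          ih fun t ht => hs t (Multiset.mem_cons_of_mem ht), add_zero]
        refine W.v_eq_zero_of_sub_one ?_
        have := hs r (Multiset.mem_cons_self r s)
        simpa [W.v_neg] using this
    exact hgen R' hR'pos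
  have hqcoeff : ∀ i, 0 ≤ W.v (q.coeff i) :=
    W.v_coeff_prod_X_sub_C R' fun r hr => (hR'pos r hr).le
  have hev : ∀ P : F[X], algebraMap F M (P.eval 1) = (P.map (algebraMap F M)).eval 1 := by
    intro P
    rw [eval_one_map]
  have hroot : ∃ a : F, f.eval a = 0 ∧ 0 < W.v (algebraMap F M (a - 1)) := by
    apply hhens f ?_ 1
    · simp [W.v_one]
    · rw [hev, hfq, eval_mul, W.v_mul, hq1, add_zero, eval_sub, eval_X, eval_C, W.v_sub_comm]
      exact hc1
    · rw [hev, ← derivative_map, hfq, derivative_mul, eval_add, eval_mul, eval_mul]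
      have hpos : W.v (q.eval 1) < W.v ((X - C c : M[X]).eval 1 * q.derivative.eval 1) := by
        rw [hq1, W.v_mul, eval_sub, eval_X, eval_C]
        refine add_pos_of_pos_of_nonneg (by rwa [W.v_sub_comm]) ?_
        refine W.v_eval_nonneg (fun i => ?_) (by rw [W.v_one])
        rw [coeff_derivative, W.v_mul]
        refine add_nonneg (hqcoeff _) ?_
        have : ((i : M) + 1) ∈ W.integers := W.integers.add_mem (natCast_mem _ i) (one_mem _)
        exact this
      have := W.v_add_eq_left hpos
      simpa [hq1] using this
    · intro i
      have := W.v_coeff_prod_X_sub_C R hRnonneg i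
      rw [← hsplit, coeff_map] at this
      exact this
  obtain ⟨a, ha, -⟩ := hroot
  have hdeg := degree_eq_one_of_irreducible_of_root (minpoly.irreducible hint) ha
  obtain ⟨y, hy⟩ := minpoly.degree_eq_one_iff.mp hdeg
  have hgc : g c = c := by rw [← hy]; exact g.commutes y
  have := hcg g (by rwa [hD])
  rw [hgc, hc0] at this
  exact lt_irrefl _ this

/-- The extension of a discrete Henselian valuation to an algebraic closure is Galois invariant. -/
theorem v_algEquiv {Ω : Type*} [Field Ω] [Algebra F Ω] [IsGalois F Ω] (V : AddVal Ω)
    (hnorm : V.IsNormalizedOn F) (hhens : V.IsHenselianOn F) (γ : Ω ≃ₐ[F] Ω) (x : Ω) :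
    V.v (γ x) = V.v x := by
  let N := FiniteGaloisIntermediateField.adjoin F {x}
  have hx : x ∈ N.toIntermediateField :=
    FiniteGaloisIntermediateField.subset_adjoin F {x} rfl
  let W := V.comap (algebraMap N Ω)
  have hW : ∀ y : F, W.v (algebraMap F N y) = V.v (algebraMap F Ω y) := fun y => rfl
  have h := v_algEquiv_of_finite (F := F) W hnorm hhens (AlgEquiv.restrictNormal γ N) ⟨x, hx⟩
  have h2 := AlgEquiv.restrictNormal_commutes γ N ⟨x, hx⟩
  change V.v (algebraMap N Ω _) = V.v (algebraMap N Ω _) at h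
  rw [h2] at h
  exact h

end Invariance
end AddVal

section Monogenic

open Polynomial IsLocalRing

variable {R S : Type*} [CommRing R] [CommRing S] [Algebra R S]
    [IsLocalRing S] [IsLocalRing R] [Module.Finite R S] [FaithfulSMul R S]

/-- Among the lifts of a simple root of a residual polynomial, one makes the value of the polynomial
a generator of the maximal ideal. -/
lemma IsLocalRing.exists_lift_maximalIdeal_eq_span {ϖ : S} (hϖ : maximalIdeal S = Ideal.span {ϖ})
    (g : S[X]) (a : S) (ha : g.eval a ∈ maximalIdeal S)
    (ha' : g.derivative.eval a ∉ maximalIdeal S) :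
    ∃ b, residue S b = residue S a ∧ maximalIdeal S = Ideal.span {g.eval b} := by
  have hϖm : ϖ ∈ maximalIdeal S := by rw [hϖ]; exact Ideal.mem_span_singleton_self ϖ
  obtain ⟨u, hu⟩ := Ideal.mem_span_singleton'.mp (hϖ ▸ ha)
  by_cases hun : IsUnit u
  · refine ⟨a, rfl, ?_⟩
    rw [hϖ, ← hu, Ideal.span_singleton_mul_left_unit hun]
  · refine ⟨a + ϖ, ?_, ?_⟩
    · rw [map_add, (residue_eq_zero_iff ϖ).mpr hϖm, add_zero]
    · obtain ⟨k, hk⟩ := g.binomExpansion a ϖ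
      have h1 : g.eval (a + ϖ) = (u + g.derivative.eval a + k * ϖ) * ϖ := by
        rw [hk, ← hu]; ring
      have hunit : IsUnit (u + g.derivative.eval a + k * ϖ) := by
        rw [← IsLocalRing.notMem_maximalIdeal]
        intro h
        apply ha'
        have h2 : g.derivative.eval a = (u + g.derivative.eval a + k * ϖ) - u - k * ϖ := by ring
        rw [h2]
        exact Ideal.sub_mem _ (Ideal.sub_mem _ h ((mem_maximalIdeal u).mpr hun))
          (Ideal.mul_mem_left _ _ hϖm)
      rw [hϖ, h1, Ideal.span_singleton_mul_left_unit hunit]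

/-- A finite extension of local rings with separable residue extension and principal maximal ideal
upstairs is monogenic. -/
theorem IsLocalRing.exists_adjoin_eq_top_of_principal
    [Algebra.IsSeparable (ResidueField R) (ResidueField S)]
    {ϖ : S} (hϖ : maximalIdeal S = Ideal.span {ϖ}) {n : ℕ}
    (hn : maximalIdeal S ^ n ≤ (maximalIdeal R).map (algebraMap R S)) :
    ∃ α : S, Algebra.adjoin R {α} = ⊤ := by
  obtain ⟨α₀, hα₀⟩ := Field.exists_primitive_element (ResidueField R) (ResidueField S)
  obtain ⟨a, ha⟩ := residue_surjective (R := S) α₀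
  have hadj : Algebra.adjoin (ResidueField R) {α₀} = ⊤ := by
    rw [← IntermediateField.adjoin_simple_toSubalgebra_of_isAlgebraic (IsAlgebraic.of_finite _ _),
      hα₀, IntermediateField.top_toSubalgebra]
  obtain ⟨f, hf⟩ := Polynomial.map_surjective _ residue_surjective (minpoly (ResidueField R) α₀)
  have hres : ∀ P : R[X], ∀ s : S, residue S (aeval s P) = aeval (residue S s) (P.map (residue R)) :=
    fun P s => map_aeval_eq_aeval_map (ψ := residue S) (φ := residue R) rfl P s
  obtain ⟨α, hα, hmα⟩ := exists_lift_maximalIdeal_eq_span hϖ (f.map (algebraMap R S)) a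
    (by
      rw [← residue_eq_zero_iff, eval_map_algebraMap, hres, ha, hf, minpoly.aeval])
    (by
      rw [← residue_eq_zero_iff, derivative_map, eval_map_algebraMap, hres, ha,
        ← derivative_map, hf]
      exact (Algebra.IsSeparable.isSeparable (ResidueField R) α₀).aeval_derivative_ne_zero
        (minpoly.aeval _ _))
  refine ⟨α, ?_⟩
  set A := Algebra.adjoin R {α}
  set t := (f.map (algebraMap R S)).eval α with ht
  have htA : t ∈ A := by
    rw [ht, eval_map_algebraMap]
    exact aeval_mem_adjoin_singleton R α
  have hstep : ∀ s : S, ∃ b ∈ A, s - b ∈ maximalIdeal S := by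
    intro s
    have hs : residue S s ∈ Algebra.adjoin (ResidueField R) {α₀} := hadj ▸ Algebra.mem_top
    rw [Algebra.adjoin_singleton_eq_range_aeval] at hs
    obtain ⟨p, hp⟩ := hs
    obtain ⟨q, rfl⟩ := Polynomial.map_surjective _ residue_surjective p
    refine ⟨aeval α q, aeval_mem_adjoin_singleton R α, ?_⟩
    rw [← residue_eq_zero_iff, map_sub, hres, hα, ha]
    exact sub_eq_zero.mpr hp.symm
  have hpow : ∀ m : ℕ, ∀ s : S, ∃ b ∈ A, s - b ∈ maximalIdeal S ^ m := by
    intro m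
    induction m with
    | zero => exact fun s => ⟨0, A.zero_mem, by simp⟩
    | succ m ih =>
      intro s
      obtain ⟨b, hb, hsb⟩ := ih s
      rw [hmα, Ideal.span_singleton_pow, Ideal.mem_span_singleton'] at hsb
      obtain ⟨y, hy⟩ := hsb
      obtain ⟨c, hc, hyc⟩ := hstep y
      refine ⟨b + c * t ^ m, A.add_mem hb (A.mul_mem hc (A.pow_mem htA m)), ?_⟩
      have : s - (b + c * t ^ m) = t ^ m * (y - c) := by
        rw [← sub_sub, ← hy]; ring
      rw [this, pow_succ]
      refine Ideal.mul_mem_mul ?_ hyc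
      rw [hmα, Ideal.span_singleton_pow]
      exact Ideal.mem_span_singleton_self _
  rw [eq_top_iff]
  refine Submodule.le_of_le_smul_of_le_jacobson_bot
      (Module.finite_def.mp inferInstance) (IsLocalRing.maximalIdeal_le_jacobson ⊥)
      (?_ : ⊤ ≤ A.toSubmodule ⊔ maximalIdeal R • ⊤)
  intro s _
  obtain ⟨b, hb, hsb⟩ := hpow n s
  rw [Ideal.smul_top_eq_map]
  exact Submodule.mem_sup.mpr ⟨b, hb, s - b, hn hsb, by ring⟩

end Monogenic

namespace AddVal
section Ring

open IsLocalRing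

/-- The valuation ring of `W`. -/
def vr {L : Type*} [Field L] (W : AddVal L) : ValuationSubring L where
  toSubring := W.integers
  mem_or_inv_mem' x := by
    by_cases hx : x = 0
    · left
      rw [hx]
      exact W.integers.zero_mem
    · obtain ⟨a, ha⟩ := W.exists_real hx
      have hb := W.v_inv_eq hx ha
      rcases le_total 0 a with h | h
      · left
        change 0 ≤ W.v x
        rw [ha]
        exact_mod_cast h
      · right
        change 0 ≤ W.v x⁻¹
        rw [hb]
        exact_mod_cast neg_nonneg.mpr h

variable {L : Type*} [Field L] (W : AddVal L)

lemma mem_vr {x : L} : x ∈ W.vr ↔ 0 ≤ W.v x := Iff.rfl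

/-- The value group of `W` is `(1/e)ℤ`. -/
def HasIdx (e : ℕ) : Prop :=
  0 < e ∧ (∀ x : L, x ≠ 0 → ∃ k : ℤ, W.v x = (((k : ℝ) / (e : ℝ) : ℝ) : WithTop ℝ)) ∧
    ∃ x : L, W.v x = ((1 / (e : ℝ) : ℝ) : WithTop ℝ)

variable {W}

lemma mul_inv_mem {x y : L} (hy : y ≠ 0) (h : W.v y ≤ W.v x) : 0 ≤ W.v (x * y⁻¹) := by
  obtain ⟨b, hb⟩ := W.exists_real hy
  by_cases hx : x = 0
  · simp [hx, W.v_zero]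
  obtain ⟨a, ha⟩ := W.exists_real hx
  rw [W.v_mul, W.v_inv_eq hy hb, ha]
  rw [ha, hb] at h
  have : b ≤ a := by exact_mod_cast h
  have : (0 : ℝ) ≤ a + -b := by linarith
  exact_mod_cast this

lemma isUnit_vr {x : W.vr} : IsUnit x ↔ W.v (x : L) = 0 := by
  constructor
  · rintro ⟨u, rfl⟩
    have h1 : (0 : WithTop ℝ) ≤ W.v ((u : W.vr) : L) := (u : W.vr).2
    have h2 : (0 : WithTop ℝ) ≤ W.v (((u⁻¹ : W.vrˣ) : W.vr) : L) := ((u⁻¹ : W.vrˣ) : W.vr).2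
    have h3 : W.v ((u : W.vr) : L) + W.v (((u⁻¹ : W.vrˣ) : W.vr) : L) = 0 := by
      rw [← W.v_mul, ← W.v_one]
      congr 1
      exact_mod_cast congrArg Subtype.val (u.mul_inv)
    refine le_antisymm ?_ h1
    rw [← h3]
    exact le_add_of_nonneg_right h2
  · intro h
    have hx : (x : L) ≠ 0 := by
      intro h0
      rw [h0, W.v_zero] at h
      exact absurd h (by simp)
    refine ⟨⟨x, ⟨(x : L)⁻¹, ?_⟩, ?_, ?_⟩, rfl⟩
    · have := mul_inv_mem (W := W) (x := 1) hx (by rw [h, W.v_one])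
      rw [one_mul] at this
      exact this
    · ext
      exact mul_inv_cancel₀ hx
    · ext
      exact inv_mul_cancel₀ hx

lemma mem_maximalIdeal_vr {x : W.vr} : x ∈ maximalIdeal W.vr ↔ 0 < W.v (x : L) := by
  rw [mem_maximalIdeal, mem_nonunits_iff, isUnit_vr]
  have : (0 : WithTop ℝ) ≤ W.v (x : L) := x.2
  exact ⟨fun h => lt_of_le_of_ne this (Ne.symm h), fun h => h.ne'⟩

lemma HasIdx.one_div_le {e : ℕ} (he : W.HasIdx e) {x : L} (hx : 0 < W.v x) :
    ((1 / (e : ℝ) : ℝ) : WithTop ℝ) ≤ W.v x := by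
  by_cases h0 : x = 0
  · simp [h0, W.v_zero]
  obtain ⟨k, hk⟩ := he.2.1 x h0
  have hpos : (0 : ℝ) < e := by exact_mod_cast he.1
  rw [hk] at hx ⊢
  have h1 : (0 : ℝ) < (k : ℝ) / e := by exact_mod_cast hx
  have h2 : (0 : ℝ) < k := by
    by_contra hcon
    exact absurd h1 (not_lt.mpr (div_nonpos_of_nonpos_of_nonneg (not_lt.mp hcon) hpos.le))
  have h3 : (1 : ℝ) ≤ k := by exact_mod_cast (show (0 : ℤ) < k by exact_mod_cast h2)
  exact_mod_cast (div_le_div_iff_of_pos_right hpos).mpr h3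

lemma HasIdx.one_div_pos {e : ℕ} (he : W.HasIdx e) : (0 : WithTop ℝ) < ((1 / (e : ℝ) : ℝ)) := by
  have hpos : (0 : ℝ) < e := by exact_mod_cast he.1
  exact_mod_cast _root_.one_div_pos.mpr hpos

lemma HasIdx.exists_uniformizer {e : ℕ} (he : W.HasIdx e) :
    ∃ ϖ : W.vr, W.v (ϖ : L) = ((1 / (e : ℝ) : ℝ) : WithTop ℝ) := by
  obtain ⟨x, hx⟩ := he.2.2
  exact ⟨⟨x, by rw [mem_vr, hx]; exact he.one_div_pos.le⟩, hx⟩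

lemma dvd_vr {x y : W.vr} : x ∣ y ↔ W.v (x : L) ≤ W.v (y : L) := by
  constructor
  · rintro ⟨z, rfl⟩
    have : (0 : WithTop ℝ) ≤ W.v (z : L) := z.2
    change _ ≤ W.v ((x : L) * z)
    rw [W.v_mul]
    exact le_add_of_nonneg_right this
  · intro h
    by_cases hx : (x : L) = 0
    · rw [hx, W.v_zero, top_le_iff, W.v_eq_top_iff] at h
      exact ⟨0, Subtype.ext (by simp [h])⟩
    · refine ⟨⟨y * (x : L)⁻¹, mul_inv_mem hx h⟩, Subtype.ext ?_⟩
      change (y : L) = x * (y * (x : L)⁻¹)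
      field_simp

lemma HasIdx.maximalIdeal_eq {e : ℕ} (he : W.HasIdx e) {ϖ : W.vr}
    (hϖ : W.v (ϖ : L) = ((1 / (e : ℝ) : ℝ) : WithTop ℝ)) :
    maximalIdeal W.vr = Ideal.span {ϖ} := by
  ext x
  rw [mem_maximalIdeal_vr, Ideal.mem_span_singleton, dvd_vr, hϖ]
  exact ⟨he.one_div_le, fun h => he.one_div_pos.trans_le h⟩

lemma vr_pow_v {e : ℕ} {ϖ : W.vr}
    (hϖ : W.v (ϖ : L) = ((1 / (e : ℝ) : ℝ) : WithTop ℝ)) (n : ℕ) :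
    W.v ((ϖ ^ n : W.vr) : L) = (((n : ℝ) / (e : ℝ) : ℝ) : WithTop ℝ) := by
  rw [SubmonoidClass.coe_pow, W.v_pow, hϖ, ← WithTop.coe_nsmul]
  congr 1
  simp [div_eq_mul_inv]

lemma HasIdx.isDiscreteValuationRing {e : ℕ} (he : W.HasIdx e) :
    IsDiscreteValuationRing W.vr := by
  obtain ⟨ϖ, hϖ⟩ := he.exists_uniformizer
  have hmax := he.maximalIdeal_eq hϖ
  have hpos : (0 : ℝ) < e := by exact_mod_cast he.1
  have hne : ϖ ≠ 0 := by
    rintro rfl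
    rw [ZeroMemClass.coe_zero, W.v_zero] at hϖ
    exact WithTop.top_ne_coe hϖ
  apply IsDiscreteValuationRing.ofHasUnitMulPowIrreducibleFactorization
  refine ⟨ϖ, ?_, ?_⟩
  · refine Prime.irreducible ?_
    rw [← Ideal.span_singleton_prime hne, ← hmax]
    infer_instance
  · intro x hx
    have hx' : (x : L) ≠ 0 := fun h => hx (Subtype.ext h)
    obtain ⟨k, hk⟩ := he.2.1 x hx'
    have hx0 : (0 : WithTop ℝ) ≤ W.v (x : L) := x.2
    rw [hk] at hx0
    have h1 : (0 : ℝ) ≤ (k : ℝ) / e := by exact_mod_cast hx0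
    have h2 : (0 : ℤ) ≤ k := by
      have : (0 : ℝ) ≤ k := by
        by_contra hcon
        exact absurd h1 (not_le.mpr (div_neg_of_neg_of_pos (not_le.mp hcon) hpos))
      exact_mod_cast this
    lift k to ℕ using h2
    refine ⟨k, associated_of_dvd_dvd ?_ ?_⟩ <;>
    · rw [dvd_vr, vr_pow_v hϖ, hk]
      simp

end Ring

section Perfect

open IsLocalRing

variable {L : Type*} [Field L] {W : AddVal L}

/-- The residue field of `W` is perfect. -/
def HasPerfectResidue (W : AddVal L) : Prop :=
  ∀ p : ℕ, p.Prime → 0 < W.v (p : L) → ∀ x : L, 0 ≤ W.v x →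
    ∃ y : L, 0 ≤ W.v y ∧ 0 < W.v (x - y ^ p)

lemma map_eq_zero_iff_vr {k : Type*} [Field k] {π : W.vr →+* k} (hπ : Function.Surjective π)
    (x : W.vr) : π x = 0 ↔ 0 < W.v (x : L) := by
  rw [← mem_maximalIdeal_vr, ← RingHom.mem_ker]
  have := RingHom.ker_isMaximal_of_surjective π hπ
  rw [IsLocalRing.eq_maximalIdeal this]

lemma HasPerfectResidue.perfectField (hW : W.HasPerfectResidue) {k : Type*} [Field k]
    {π : W.vr →+* k} (hπ : Function.Surjective π) : PerfectField k := by
  rcases CharP.exists' k with h | ⟨p, hp, hk⟩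
  · infer_instance
  · have : ExpChar k p := ExpChar.prime hp.out
    have : PerfectRing k p := PerfectRing.ofSurjective k p fun x => by
      obtain ⟨x, rfl⟩ := hπ x
      obtain ⟨y, hy, hxy⟩ := hW p hp.out (by
        have := (map_eq_zero_iff_vr hπ (p : W.vr)).mp (by simp)
        simpa using this) x x.2
      refine ⟨π ⟨y, hy⟩, ?_⟩
      have := (map_eq_zero_iff_vr hπ (x - ⟨y, hy⟩ ^ p)).mpr hxy
      rw [map_sub, map_pow, sub_eq_zero] at this
      exact this.symm
    exact PerfectRing.toPerfectField k p

lemma hasPerfectResidue_of_perfectField [PerfectField (ResidueField W.vr)] :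
    W.HasPerfectResidue := by
  intro p hp hpv x hx
  have hsurj := residue_surjective (R := W.vr)
  have hp0 : ((p : ℕ) : ResidueField W.vr) = 0 := by
    have := (map_eq_zero_iff_vr hsurj (p : W.vr)).mpr (by simpa using hpv)
    simpa using this
  have : CharP (ResidueField W.vr) p := by
    refine (CharP.charP_iff_prime_eq_zero hp).mpr hp0
  have : Fact p.Prime := ⟨hp⟩
  have : ExpChar (ResidueField W.vr) p := ExpChar.prime hp
  obtain ⟨y, hy⟩ := PerfectRing.bijective_frobenius (R := ResidueField W.vr) (p := p) |>.2
    (residue W.vr ⟨x, hx⟩)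
  obtain ⟨y, rfl⟩ := hsurj y
  refine ⟨y, y.2, ?_⟩
  refine (map_eq_zero_iff_vr hsurj (⟨x, hx⟩ - y ^ p)).mp ?_
  rw [map_sub, map_pow, ← hy]
  exact sub_self _

end Perfect
end AddVal

namespace AddVal
section Extension

open IsLocalRing Polynomial

variable {K L : Type*} [Field K] [Field L] [Algebra K L] (W : AddVal L)

instance vrAlgebra : Algebra (W.comap (algebraMap K L)).vr W.vr :=
  RingHom.toAlgebra
    { toFun := fun x => ⟨algebraMap K L x, x.2⟩
      map_one' := Subtype.ext (by simp)
      map_mul' := fun x y => Subtype.ext (by simp)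
      map_zero' := Subtype.ext (by simp)
      map_add' := fun x y => Subtype.ext (by simp) }

@[simp] lemma coe_algebraMap_vr (x : (W.comap (algebraMap K L)).vr) :
    ((algebraMap (W.comap (algebraMap K L)).vr W.vr x : W.vr) : L) = algebraMap K L x := rfl

instance : IsScalarTower (W.comap (algebraMap K L)).vr W.vr L :=
  IsScalarTower.of_algebraMap_eq fun _ => rfl

instance : FaithfulSMul (W.comap (algebraMap K L)).vr W.vr := by
  rw [faithfulSMul_iff_algebraMap_injective]
  intro x y h
  exact Subtype.ext ((algebraMap K L).injective (congrArg Subtype.val h))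

/-- The minimal polynomials of integral elements are integral. -/
def MinpolyIntegral (K : Type*) [Field K] [Algebra K L] (W : AddVal L) : Prop :=
  ∀ x : L, 0 ≤ W.v x → ∀ i, 0 ≤ W.v (algebraMap K L ((minpoly K x).coeff i))

variable {W}

lemma isIntegralClosure_vr [Algebra.IsIntegral K L] (h : MinpolyIntegral K W) :
    IsIntegralClosure W.vr (W.comap (algebraMap K L)).vr L where
  algebraMap_injective := Subtype.val_injective
  isIntegral_iff {x} := by
    constructor
    · intro hx
      exact IsIntegrallyClosed.isIntegral_iff.mp (hx.tower_top (A := W.vr))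
    · rintro ⟨y, rfl⟩
      have hlift : minpoly K (y : L) ∈
          lifts (algebraMap (W.comap (algebraMap K L)).vr K) := by
        rw [lifts_iff_coeff_lifts]
        intro i
        exact ⟨⟨(minpoly K (y : L)).coeff i, h y y.2 i⟩, rfl⟩
      obtain ⟨q, hq, -, hqm⟩ := lifts_and_natDegree_eq_and_monic hlift
        (minpoly.monic (Algebra.IsIntegral.isIntegral _))
      refine ⟨q, hqm, ?_⟩
      change eval₂ _ (y : L) q = 0
      rw [IsScalarTower.algebraMap_eq (W.comap (algebraMap K L)).vr K L, ← eval₂_map, hq]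
      exact minpoly.aeval K (y : L)

lemma isIntegral_vr [Algebra.IsIntegral K L] (h : MinpolyIntegral K W) :
    Algebra.IsIntegral (W.comap (algebraMap K L)).vr W.vr :=
  have := isIntegralClosure_vr h
  IsIntegralClosure.isIntegral_algebra _ L

lemma finite_vr [FiniteDimensional K L] [Algebra.IsSeparable K L] (h : MinpolyIntegral K W) {e : ℕ}
    (he : (W.comap (algebraMap K L)).HasIdx e) :
    Module.Finite (W.comap (algebraMap K L)).vr W.vr :=
  have := isIntegralClosure_vr h
  have := he.isDiscreteValuationRing
  IsIntegralClosure.finite _ K L _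

lemma HasPerfectResidue.of_comap [Algebra.IsIntegral K L] (h : MinpolyIntegral K W)
    (hp : (W.comap (algebraMap K L)).HasPerfectResidue) : W.HasPerfectResidue := by
  have := isIntegral_vr h
  have : PerfectField (ResidueField (W.comap (algebraMap K L)).vr) :=
    hp.perfectField residue_surjective
  have : Algebra.IsIntegral (W.comap (algebraMap K L)).vr (ResidueField W.vr) :=
    Algebra.IsIntegral.of_surjective (IsScalarTower.toAlgHom _ W.vr (ResidueField W.vr))
      residue_surjective
  have : Algebra.IsIntegral (ResidueField (W.comap (algebraMap K L)).vr) (ResidueField W.vr) :=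
    Algebra.IsIntegral.tower_top (W.comap (algebraMap K L)).vr
  have : PerfectField (ResidueField W.vr) :=
    Algebra.IsAlgebraic.perfectField (K := ResidueField (W.comap (algebraMap K L)).vr)
  exact hasPerfectResidue_of_perfectField

/-- The valuation ring upstairs is generated by one element. -/
theorem exists_generator [FiniteDimensional K L] [Algebra.IsSeparable K L]
    (h : MinpolyIntegral K W) (hp : (W.comap (algebraMap K L)).HasPerfectResidue) {e e' : ℕ}
    (he : (W.comap (algebraMap K L)).HasIdx e) (he' : W.HasIdx e') :
    ∃ α : L, 0 ≤ W.v α ∧ ∀ x : L, 0 ≤ W.v x →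
      ∃ P : K[X], (∀ i, 0 ≤ W.v (algebraMap K L (P.coeff i))) ∧ aeval α P = x := by
  have := finite_vr h he
  have := isIntegral_vr h
  have : PerfectField (ResidueField (W.comap (algebraMap K L)).vr) :=
    hp.perfectField residue_surjective
  obtain ⟨ϖ, hϖ⟩ := he.exists_uniformizer
  obtain ⟨ϖ', hϖ'⟩ := he'.exists_uniformizer
  have hpos : (0 : ℝ) < e := by exact_mod_cast he.1
  have hn : maximalIdeal W.vr ^ e' ≤
      (maximalIdeal (W.comap (algebraMap K L)).vr).map (algebraMap _ W.vr) := by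
    rw [he'.maximalIdeal_eq hϖ', he.maximalIdeal_eq hϖ, Ideal.map_span, Set.image_singleton,
      Ideal.span_singleton_pow, Ideal.span_singleton_le_span_singleton, dvd_vr, vr_pow_v hϖ']
    change W.v (algebraMap K L ϖ) ≤ _
    have : W.v (algebraMap K L ϖ) = _ := hϖ
    rw [this, div_self (by exact_mod_cast he'.1.ne')]
    have h1 : (1 : ℝ) ≤ e := by exact_mod_cast he.1
    exact_mod_cast (div_le_one hpos).mpr h1
  obtain ⟨α, hα⟩ := exists_adjoin_eq_top_of_principal
    (R := (W.comap (algebraMap K L)).vr) (he'.maximalIdeal_eq hϖ') hn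
  refine ⟨α, α.2, fun x hx => ?_⟩
  have hx' : (⟨x, hx⟩ : W.vr) ∈ Algebra.adjoin (W.comap (algebraMap K L)).vr {α} :=
    hα ▸ Algebra.mem_top
  rw [Algebra.adjoin_singleton_eq_range_aeval] at hx'
  obtain ⟨q, hq⟩ := hx'
  refine ⟨q.map (algebraMap _ K), fun i => ?_, ?_⟩
  · rw [coeff_map]
    exact (q.coeff i).2
  · rw [aeval_map_algebraMap]
    have := congrArg (algebraMap W.vr L) hq
    change algebraMap W.vr L (aeval α q) = x at this
    rwa [← Polynomial.aeval_algebraMap_apply] at this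

/-- The order of the inertia group is the ramification index. -/
theorem card_inertia [FiniteDimensional K L] [IsGalois K L]
    (hinv : ∀ (g : L ≃ₐ[K] L) (x : L), W.v (g x) = W.v x)
    (h : MinpolyIntegral K W) (hp : (W.comap (algebraMap K L)).HasPerfectResidue) {e e' : ℕ}
    (he : (W.comap (algebraMap K L)).HasIdx e) (he' : W.HasIdx e') :
    Nat.card {g : L ≃ₐ[K] L // ∀ x : L, 0 ≤ W.v x → 0 < W.v (g x - x)} * e = e' := by
  have := finite_vr h he
  have := isIntegral_vr h
  have := isIntegralClosure_vr h
  have := he.isDiscreteValuationRing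
  have := he'.isDiscreteValuationRing
  obtain ⟨ϖ, hϖ⟩ := he.exists_uniformizer
  obtain ⟨ϖ', hϖ'⟩ := he'.exists_uniformizer
  let R := (W.comap (algebraMap K L)).vr
  let S := W.vr
  let p : Ideal R := maximalIdeal R
  let P : Ideal S := maximalIdeal S
  have : PerfectField p.ResidueField :=
    hp.perfectField (Ideal.algebraMap_residueField_surjective p)
  let _ : MulSemiringAction (L ≃ₐ[K] L) S :=
    { smul := fun g x => ⟨g x, by rw [mem_vr, hinv]; exact x.2⟩
      one_smul := fun x => rfl
      mul_smul := fun g h x => rfl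
      smul_zero := fun g => Subtype.ext (map_zero g)
      smul_add := fun g x y => Subtype.ext (map_add g _ _)
      smul_one := fun g => Subtype.ext (map_one g)
      smul_mul := fun g x y => Subtype.ext (map_mul g _ _) }
  have hsm : ∀ (g : L ≃ₐ[K] L) (x : S), ((g • x : S) : L) = g x := fun _ _ => rfl
  have : SMulDistribClass (L ≃ₐ[K] L) S L := ⟨fun g x y => by
    change g ((x : L) * y) = ((g • x : S) : L) * g y
    rw [map_mul, hsm]⟩
  have : IsGaloisGroup (L ≃ₐ[K] L) R S := IsGaloisGroup.of_isFractionRing _ _ _ K L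
  have hcard := Ideal.card_inertia_eq_ramificationIdxIn (G := L ≃ₐ[K] L) p P
  have hp0 : p ≠ ⊥ := IsDiscreteValuationRing.not_a_field R
  rw [Ideal.ramificationIdxIn_eq_ramificationIdx p P (L ≃ₐ[K] L),
    ← Ideal.ramificationIdx'_eq_ramificationIdx p P hp0] at hcard
  obtain ⟨k, hk⟩ := he'.2.1 (algebraMap K L ϖ) (by
    intro h0
    have h1 : W.v (algebraMap K L ϖ) = _ := hϖ
    rw [h0, W.v_zero] at h1
    exact WithTop.top_ne_coe h1)
  have hpos : (0 : ℝ) < e := by exact_mod_cast he.1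
  have hpos' : (0 : ℝ) < e' := by exact_mod_cast he'.1
  have hk2 : (1 : ℝ) / e = k / e' := by
    have h1 : W.v (algebraMap K L ϖ) = _ := hϖ
    rw [h1] at hk
    exact_mod_cast hk
  have hke : (k : ℝ) * e = e' := by
    field_simp at hk2
    linarith
  have hk0 : 0 ≤ k := by
    have : (0 : ℝ) < k := by
      by_contra hcon
      have := mul_nonpos_of_nonpos_of_nonneg (not_lt.mp hcon) hpos.le
      linarith
    exact_mod_cast this.le
  lift k to ℕ using hk0
  have hmap : ∀ m : ℕ, p.map (algebraMap R S) ≤ P ^ m ↔ m ≤ k := by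
    intro m
    rw [show p = _ from he.maximalIdeal_eq hϖ, show P = _ from he'.maximalIdeal_eq hϖ',
      Ideal.map_span, Set.image_singleton, Ideal.span_singleton_pow,
      Ideal.span_singleton_le_span_singleton, dvd_vr, vr_pow_v hϖ']
    change _ ≤ W.v (algebraMap K L ϖ) ↔ _
    rw [hk, WithTop.coe_le_coe, div_le_div_iff_of_pos_right hpos']
    norm_cast
  rw [Ideal.ramificationIdx'_spec ((hmap k).mpr le_rfl) (by rw [hmap]; lia)] at hcard
  have hcc : Nat.card {g : L ≃ₐ[K] L // ∀ x : L, 0 ≤ W.v x → 0 < W.v (g x - x)} = k := by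
    rw [← hcard]
    refine Nat.card_congr (Equiv.subtypeEquivRight fun g => ?_)
    constructor
    · intro hg x
      exact mem_maximalIdeal_vr.mpr (hg x x.2)
    · intro hg x hx
      exact mem_maximalIdeal_vr.mp (hg ⟨x, hx⟩)
  rw [hcc]
  exact_mod_cast hke

end Extension
end AddVal

/-- The real number `min x u`, for `x` in `ℝ ∪ {⊤}`. -/
def cut (x : WithTop ℝ) (u : ℝ) : ℝ := (min x (u : WithTop ℝ)).untopD 0

lemma coe_cut (x : WithTop ℝ) (u : ℝ) : (cut x u : WithTop ℝ) = min x u := by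
  induction x with
  | top => simp [cut]
  | coe a => rw [cut, ← WithTop.coe_min, WithTop.untopD_coe]

lemma cut_top (u : ℝ) : cut ⊤ u = u := by simp [cut]

lemma cut_coe (a u : ℝ) : cut (a : WithTop ℝ) u = min a u := by
  rw [cut, ← WithTop.coe_min, WithTop.untopD_coe]

lemma cut_of_le {x : WithTop ℝ} {u : ℝ} (h : (u : WithTop ℝ) ≤ x) : cut x u = u := by
  rw [cut, min_eq_right h, WithTop.untopD_coe]

lemma cut_zero_left {u : ℝ} (h : 0 ≤ u) : cut 0 u = 0 := by
  have := cut_coe 0 u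
  rw [min_eq_left h] at this
  exact_mod_cast this

lemma cut_mono (x : WithTop ℝ) : Monotone (cut x) := by
  intro u u' h
  induction x with
  | top => simpa [cut_top] using h
  | coe a => simpa only [cut_coe] using min_le_min_left a h

lemma continuous_cut (x : WithTop ℝ) : Continuous (cut x) := by
  induction x with
  | top => rw [funext cut_top]; exact continuous_id
  | coe a => rw [funext (cut_coe a)]; exact continuous_const.min continuous_id

/-- The layer cake formula for `cut`. -/
lemma integral_indicator_cut (x : WithTop ℝ) {e s : ℝ} (he : 0 < e) (hs : 0 ≤ s) :
    IntervalIntegrable (fun t : ℝ => if (((t + 1) / e : ℝ) : WithTop ℝ) ≤ x then (1 : ℝ) else 0)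
      MeasureTheory.volume 0 s ∧
    ∫ t in (0 : ℝ)..s, (if (((t + 1) / e : ℝ) : WithTop ℝ) ≤ x then (1 : ℝ) else 0) =
      e * (cut x ((s + 1) / e) - cut x (1 / e)) := by
  have hanti : Antitone
      (fun t : ℝ => if (((t + 1) / e : ℝ) : WithTop ℝ) ≤ x then (1 : ℝ) else 0) := by
    intro t t' htt
    by_cases h' : (((t' + 1) / e : ℝ) : WithTop ℝ) ≤ x
    · have h : (((t + 1) / e : ℝ) : WithTop ℝ) ≤ x := by
        refine le_trans ?_ h'
        exact_mod_cast (div_le_div_iff_of_pos_right he).mpr (by linarith)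
      simp only [h, h', if_true, le_refl]
    · simp only [h', if_false]
      split_ifs <;> norm_num
  have hint : ∀ a b : ℝ, IntervalIntegrable
      (fun t : ℝ => if (((t + 1) / e : ℝ) : WithTop ℝ) ≤ x then (1 : ℝ) else 0)
      MeasureTheory.volume a b := fun a b => hanti.intervalIntegrable
  have hone : ∀ b : ℝ, 0 ≤ b → (((b + 1) / e : ℝ) : WithTop ℝ) ≤ x →
      ∫ t in (0 : ℝ)..b, (if (((t + 1) / e : ℝ) : WithTop ℝ) ≤ x then (1 : ℝ) else 0) = b := by
    intro b hb hbx
    rw [intervalIntegral.integral_congr_ae (g := fun _ => (1 : ℝ))]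
    · simp
    · refine Filter.Eventually.of_forall fun t ht => ?_
      rw [Set.uIoc_of_le hb] at ht
      have h : (((t + 1) / e : ℝ) : WithTop ℝ) ≤ x := by
        refine le_trans ?_ hbx
        exact_mod_cast (div_le_div_iff_of_pos_right he).mpr (by linarith [ht.2])
      simp only [h, if_true]
  have hzero : ∀ a b : ℝ, a ≤ b → (∀ t, a < t → ¬ (((t + 1) / e : ℝ) : WithTop ℝ) ≤ x) →
      ∫ t in a..b, (if (((t + 1) / e : ℝ) : WithTop ℝ) ≤ x then (1 : ℝ) else 0) = 0 := by
    intro a b hab h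
    rw [intervalIntegral.integral_congr_ae (g := fun _ => (0 : ℝ))]
    · simp
    · refine Filter.Eventually.of_forall fun t ht => ?_
      rw [Set.uIoc_of_le hab] at ht
      simp only [h t ht.1, if_false]
  refine ⟨hint 0 s, ?_⟩
  by_cases hsx : (((s + 1) / e : ℝ) : WithTop ℝ) ≤ x
  · rw [hone s hs hsx, cut_of_le hsx, cut_of_le (le_trans ?_ hsx)]
    · field_simp
      ring
    · exact_mod_cast (div_le_div_iff_of_pos_right he).mpr (by linarith)
  induction x with
  | top => exact absurd le_top hsx
  | coe a =>
    have hiff : ∀ t : ℝ, (((t + 1) / e : ℝ) : WithTop ℝ) ≤ (a : WithTop ℝ) ↔ t ≤ a * e - 1 := by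
      intro t
      rw [WithTop.coe_le_coe, div_le_iff₀ he]
      constructor <;> intro h <;> linarith
    have hs' := not_le.mp (fun h => hsx ((hiff s).mpr h))
    have h2 : a ≤ (s + 1) / e := by rw [le_div_iff₀ he]; linarith
    rw [cut_coe, cut_coe, min_eq_left h2]
    by_cases hb : 0 ≤ a * e - 1
    · rw [← intervalIntegral.integral_add_adjacent_intervals (hint 0 (a * e - 1)) (hint _ s),
        hone _ hb ((hiff _).mpr le_rfl),
        hzero _ _ hs'.le (fun t ht h => absurd ((hiff t).mp h) (not_le.mpr ht)),
        min_eq_right (by rw [div_le_iff₀ he]; linarith)]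
      field_simp
      ring
    · push Not at hb
      rw [hzero 0 s hs (fun t ht h => absurd ((hiff t).mp h) (not_le.mpr (hb.trans ht))),
        min_eq_left (by rw [le_div_iff₀ he]; linarith)]
      ring

section Filtration

variable {G : Type*} [Group G] [Fintype G]

/-- An exhaustive decreasing filtration of a finite group, given by the level of its elements. -/
structure GroupLevel (G : Type*) [Group G] where
  i : G → WithTop ℝ
  nonneg : ∀ g, 0 ≤ i g
  one : i 1 = ⊤
  inv : ∀ g, i g⁻¹ = i g
  mul : ∀ g h, min (i g) (i h) ≤ i (g * h)

namespace GroupLevel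

variable (I : GroupLevel G) (H : Subgroup G)

/-- The level of a coset `g H`. -/
def cosetLevel (g : G) : WithTop ℝ := ∑ h : H, I.i (g * h)

/-- The Herbrand function of a subgroup. -/
def subPhi (u : ℝ) : ℝ := ∑ h : H, cut (I.i h) u

/-- The Herbrand function of the coset space `G/H`. -/
def quotPhi (u : ℝ) : ℝ := (∑ g : G, cut (I.cosetLevel H g) u) / Fintype.card H

omit [Fintype G] in
lemma mul_eq_of_lt {g h : G} (hlt : I.i h < I.i g) : I.i (g * h) = I.i h := by
  refine le_antisymm ?_ ((min_eq_right hlt.le).symm.trans_le (I.mul g h))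
  by_contra hcon
  have h1 := I.mul g⁻¹ (g * h)
  rw [I.inv, inv_mul_cancel_left] at h1
  exact absurd h1 (not_le.mpr (lt_min hlt (not_le.mp hcon)))

omit [Fintype G] in
lemma cut_mul_eq {g h : G} {u : ℝ} (hg : (u : WithTop ℝ) ≤ I.i g) :
    cut (I.i (g * h)) u = cut (I.i h) u := by
  by_cases hu : (u : WithTop ℝ) ≤ I.i h
  · rw [cut_of_le hu, cut_of_le ((le_min hg hu).trans (I.mul g h))]
  · rw [I.mul_eq_of_lt ((not_le.mp hu).trans_le hg)]

lemma cosetLevel_one : I.cosetLevel H 1 = ⊤ := by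
  rw [cosetLevel, WithTop.sum_eq_top]
  exact ⟨1, Finset.mem_univ _, by simp [I.one]⟩

lemma coe_sum_cut (g : G) (u : ℝ) :
    ((∑ h : H, cut (I.i (g * h)) u : ℝ) : WithTop ℝ) = ∑ h : H, min (I.i (g * h)) (u : WithTop ℝ) := by
  rw [WithTop.coe_sum]
  exact Finset.sum_congr rfl fun h _ => coe_cut _ _

lemma sum_cut_eq_of_le {g : G} {u : ℝ} {h₀ : H} (h : (u : WithTop ℝ) ≤ I.i (g * h₀)) :
    ∑ h : H, cut (I.i (g * h)) u = I.subPhi H u := by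
  rw [subPhi, ← Equiv.sum_comp (Equiv.mulLeft h₀) (fun h : H => cut (I.i (g * h)) u)]
  refine Finset.sum_congr rfl fun k _ => ?_
  rw [Equiv.coe_mulLeft, Subgroup.coe_mul, ← mul_assoc, I.cut_mul_eq h]

lemma sum_cut_eq_of_forall_lt {g : G} {u : ℝ} (h : ∀ h : H, I.i (g * h) < (u : WithTop ℝ)) :
    ((∑ h : H, cut (I.i (g * h)) u : ℝ) : WithTop ℝ) = I.cosetLevel H g := by
  rw [coe_sum_cut, cosetLevel]
  exact Finset.sum_congr rfl fun k _ => min_eq_left (h k).le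

lemma sum_cut_lt_of_forall_lt {g : G} {u : ℝ} (h : ∀ h : H, I.i (g * h) < (u : WithTop ℝ)) :
    ∑ h : H, cut (I.i (g * h)) u < I.subPhi H u := by
  obtain ⟨h₀, -, hmax⟩ := Finset.exists_max_image (Finset.univ : Finset H)
    (fun h => I.i (g * h)) ⟨1, Finset.mem_univ _⟩
  rw [subPhi, ← Equiv.sum_comp (Equiv.mulLeft h₀⁻¹) (fun h : H => cut (I.i h) u)]
  refine Finset.sum_lt_sum (fun k _ => ?_) ⟨h₀, Finset.mem_univ _, ?_⟩
  · rw [← WithTop.coe_le_coe, coe_cut, coe_cut]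
    refine min_le_min_right _ ?_
    have h1 := I.mul (g * h₀)⁻¹ (g * k)
    rw [I.inv, min_eq_right (hmax k (Finset.mem_univ _))] at h1
    convert h1 using 2
    simp [mul_assoc]
  · rw [← WithTop.coe_lt_coe, coe_cut, coe_cut]
    have : ((Equiv.mulLeft h₀⁻¹ h₀ : H) : G) = 1 := by simp
    rw [this, I.one, min_eq_right le_top, min_lt_iff]
    exact Or.inl (h h₀)

lemma sum_cut_le_cosetLevel (g : G) (u : ℝ) :
    ((∑ h : H, cut (I.i (g * h)) u : ℝ) : WithTop ℝ) ≤ I.cosetLevel H g := by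
  rw [coe_sum_cut, cosetLevel]
  exact Finset.sum_le_sum fun k _ => min_le_left _ _

/-- The level of a coset detects the levels of its members. -/
lemma subPhi_le_cosetLevel_iff {g : G} {u : ℝ} :
    (I.subPhi H u : WithTop ℝ) ≤ I.cosetLevel H g ↔ ∃ h : H, (u : WithTop ℝ) ≤ I.i (g * h) := by
  constructor
  · intro h
    by_contra! hcon
    have h1 := I.sum_cut_lt_of_forall_lt H hcon
    rw [← I.sum_cut_eq_of_forall_lt H hcon, WithTop.coe_le_coe] at h
    exact absurd h1 (not_lt.mpr h)
  · rintro ⟨h₀, h⟩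
    rw [← I.sum_cut_eq_of_le H h]
    exact I.sum_cut_le_cosetLevel H g u

lemma cut_cosetLevel (g : G) (u : ℝ) :
    cut (I.cosetLevel H g) (I.subPhi H u) = ∑ h : H, cut (I.i (g * h)) u := by
  by_cases h : ∃ h : H, (u : WithTop ℝ) ≤ I.i (g * h)
  · rw [cut_of_le ((I.subPhi_le_cosetLevel_iff H).mpr h)]
    obtain ⟨h₀, h⟩ := h
    rw [I.sum_cut_eq_of_le H h]
  · push Not at h
    rw [← I.sum_cut_eq_of_forall_lt H h, cut_coe, min_eq_left (I.sum_cut_lt_of_forall_lt H h).le]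

/-- Transitivity of Herbrand functions. -/
lemma quotPhi_subPhi (u : ℝ) :
    I.quotPhi H (I.subPhi H u) = ∑ g : G, cut (I.i g) u := by
  have hH : (Fintype.card H : ℝ) ≠ 0 := by exact_mod_cast Fintype.card_ne_zero
  rw [quotPhi, div_eq_iff hH, Finset.sum_congr rfl fun g _ => I.cut_cosetLevel H g u,
    Finset.sum_comm]
  have : ∀ h : H, ∑ g : G, cut (I.i (g * h)) u = ∑ g : G, cut (I.i g) u := fun h =>
    Equiv.sum_comp (Equiv.mulRight (h : G)) fun g => cut (I.i g) u
  rw [Finset.sum_congr rfl fun h _ => this h, Finset.sum_const, Finset.card_univ, nsmul_eq_mul,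
    mul_comm]

lemma continuous_quotPhi : Continuous (I.quotPhi H) := by
  unfold quotPhi
  exact (continuous_finsetSum _ fun g _ => continuous_cut _).div_const _

lemma quotPhi_sub_ge {u u' : ℝ} (h : u ≤ u') :
    (u' - u) / Fintype.card H ≤ I.quotPhi H u' - I.quotPhi H u := by
  have hH : (0 : ℝ) < (Fintype.card H : ℝ) := by exact_mod_cast Fintype.card_pos
  rw [quotPhi, quotPhi, ← sub_div, div_le_div_iff_of_pos_right hH, ← Finset.sum_sub_distrib]
  have h1 := Finset.single_le_sum
    (f := fun g : G => cut (I.cosetLevel H g) u' - cut (I.cosetLevel H g) u)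
    (fun g _ => sub_nonneg.mpr (cut_mono _ h)) (Finset.mem_univ 1)
  simpa only [cosetLevel_one, cut_top] using h1

lemma quotPhi_strictMono : StrictMono (I.quotPhi H) := by
  intro u u' h
  have h1 := I.quotPhi_sub_ge H h.le
  have hH : (0 : ℝ) < (Fintype.card H : ℝ) := by exact_mod_cast Fintype.card_pos
  have : 0 < (u' - u) / (Fintype.card H : ℝ) := div_pos (by linarith) hH
  linarith

end GroupLevel
end Filtration

namespace AddVal
section GaloisLevel

open Polynomial

/-- The valuation is invariant under the Galois group. -/
def IsInvariant (K : Type*) {L : Type*} [Field K] [Field L] [Algebra K L] (W : AddVal L) : Prop :=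
  ∀ (g : L ≃ₐ[K] L) (x : L), W.v (g x) = W.v x

lemma IsInvariant.minpolyIntegral {K L : Type*} [Field K] [Field L] [Algebra K L] [Normal K L]
    {W : AddVal L} (hinv : W.IsInvariant K) : W.MinpolyIntegral K := by
  intro x hx i
  have hint : IsIntegral K x := Algebra.IsIntegral.isIntegral x
  have hsplit := (Normal.splits (inferInstance : Normal K L) x).eq_prod_roots_of_monic
    ((minpoly.monic hint).map _)
  rw [← coeff_map, hsplit]
  refine W.v_coeff_prod_X_sub_C _ (fun r hr => ?_) i
  have h1 : IsConjRoot K x r := (isConjRoot_iff_mem_minpoly_aroots hint).mpr hr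
  obtain ⟨h, rfl⟩ := isConjRoot_iff_exists_algEquiv.mp h1.symm
  rwa [hinv]

lemma le_v_eval {L : Type*} [Field L] (W : AddVal L) {P : L[X]} {c : WithTop ℝ}
    (hP : ∀ i, c ≤ W.v (P.coeff i)) {x : L} (hx : 0 ≤ W.v x) : c ≤ W.v (P.eval x) := by
  rw [eval_eq_sum_range]
  refine Finset.sum_induction _ (fun y => c ≤ W.v y) (fun _ _ => W.le_v_add)
    (by rw [W.v_zero]; exact le_top) fun i _ => ?_
  rw [W.v_mul, W.v_pow]
  exact (hP i).trans (le_add_of_nonneg_right (nsmul_nonneg hx i))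

lemma v_sub_le_v_pow_sub_pow {L : Type*} [Field L] (W : AddVal L) {x y : L} (hx : 0 ≤ W.v x)
    (hy : 0 ≤ W.v y) (n : ℕ) : W.v (x - y) ≤ W.v (x ^ n - y ^ n) := by
  induction n with
  | zero => simp [W.v_zero]
  | succ n ih =>
    have : x ^ (n + 1) - y ^ (n + 1) = x * (x ^ n - y ^ n) + (x - y) * y ^ n := by ring
    rw [this]
    refine W.le_v_add ?_ ?_
    · rw [W.v_mul]
      exact ih.trans (le_add_of_nonneg_left hx)
    · rw [W.v_mul, W.v_pow]
      exact le_add_of_nonneg_right (nsmul_nonneg hy n)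

variable {F M : Type*} [Field F] [Field M] [Algebra F M] {W : AddVal M}

/-- An integral element generating the valuation ring of `M` over that of `F`. -/
structure IsIntegralGenerator (F : Type*) {M : Type*} [Field F] [Field M] [Algebra F M]
    (W : AddVal M) (α : M) : Prop where
  nonneg : 0 ≤ W.v α
  exists_aeval : ∀ x : M, 0 ≤ W.v x →
    ∃ P : F[X], (∀ i, 0 ≤ W.v (algebraMap F M (P.coeff i))) ∧ aeval α P = x

/-- The level of the elements of the Galois group in the ramification filtration. -/
def galLevel (hinv : W.IsInvariant F) {α : M} (hα : 0 ≤ W.v α) : GroupLevel (M ≃ₐ[F] M) where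
  i g := W.v (g α - α)
  nonneg g := W.le_v_sub (by rwa [hinv]) hα
  one := by simp [W.v_zero]
  inv g := by
    rw [← hinv g, map_sub, ← AlgEquiv.mul_apply, mul_inv_cancel, AlgEquiv.one_apply,
      W.v_sub_comm]
  mul g h := by
    have : (g * h) α - α = g (h α - α) + (g α - α) := by
      rw [map_sub, AlgEquiv.mul_apply]; ring
    rw [this]
    exact W.le_v_add (by rw [hinv]; exact min_le_right _ _) (min_le_left _ _)

variable (hinv : W.IsInvariant F) {α : M} (hα : W.IsIntegralGenerator F α)

lemma le_galLevel_iff {c : WithTop ℝ} {g : M ≃ₐ[F] M} :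
    c ≤ (galLevel hinv hα.nonneg).i g ↔ ∀ x : M, 0 ≤ W.v x → c ≤ W.v (g x - x) := by
  constructor
  · intro h x hx
    obtain ⟨P, hP, rfl⟩ := hα.exists_aeval x hx
    have h1 : g (aeval α P) = aeval (g α) P := (aeval_algHom_apply g.toAlgHom α P).symm
    rw [h1, aeval_eq_sum_range, aeval_eq_sum_range, ← Finset.sum_sub_distrib]
    refine Finset.sum_induction _ (fun y => c ≤ W.v y) (fun _ _ => W.le_v_add)
      (by rw [W.v_zero]; exact le_top) fun i _ => ?_
    rw [← smul_sub, Algebra.smul_def, W.v_mul]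
    exact h.trans ((W.v_sub_le_v_pow_sub_pow (by rw [hinv]; exact hα.nonneg) hα.nonneg i).trans
      (le_add_of_nonneg_left (hP i)))
  · exact fun h => h α hα.nonneg

include hinv hα in
lemma eq_of_apply_eq {g h : M ≃ₐ[F] M} (hgh : g α = h α) : g = h := by
  have h1 : (⊤ : WithTop ℝ) ≤ (galLevel hinv hα.nonneg).i (h⁻¹ * g) := by
    change ⊤ ≤ W.v _
    rw [AlgEquiv.mul_apply, hgh, ← AlgEquiv.mul_apply, inv_mul_cancel, AlgEquiv.one_apply, sub_self, W.v_zero]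
  rw [le_galLevel_iff hinv hα] at h1
  have h2 : ∀ x : M, 0 ≤ W.v x → h⁻¹ (g x) = x := fun x hx =>
    sub_eq_zero.mp (W.v_eq_top_iff.mp (top_le_iff.mp (h1 x hx)))
  have h3 : h⁻¹ * g = 1 := by
    ext x
    rw [AlgEquiv.mul_apply, AlgEquiv.one_apply]
    rcases le_total 0 (W.v x) with hx | hx
    · exact h2 x hx
    · have hx0 : x ≠ 0 := by
        rintro rfl
        rw [W.v_zero] at hx
        exact absurd hx (by simp)
      have h4 : 0 ≤ W.v x⁻¹ := by
        have := W.mul_inv_mem (x := 1) hx0 (by rwa [W.v_one])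
        rwa [one_mul] at this
      have := h2 _ h4
      rwa [map_inv₀, map_inv₀, inv_inj] at this
  rw [← mul_one h, ← h3, mul_inv_cancel_left]

variable [FiniteDimensional F M] (E : IntermediateField F M)

lemma cosetLevel_eq (g : M ≃ₐ[F] M) :
    (galLevel hinv hα.nonneg).cosetLevel E.fixingSubgroup g =
      W.v (∏ h : E.fixingSubgroup, (α - g ((h : M ≃ₐ[F] M) α))) := by
  rw [W.v_prod]
  exact Finset.sum_congr rfl fun h _ => W.v_sub_comm _ _

/-- The product of the `X - h α` over the group fixing `E`. -/
def orbitPoly (α : M) : M[X] := ∏ h : E.fixingSubgroup, (X - C ((h : M ≃ₐ[F] M) α))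

lemma orbitPoly_map (g : M ≃ₐ[F] M) :
    ((orbitPoly E α).map (g : M →+* M)) =
      ∏ h : E.fixingSubgroup, (X - C (g ((h : M ≃ₐ[F] M) α))) := by
  rw [orbitPoly, Polynomial.map_prod]
  exact Finset.prod_congr rfl fun h _ => by simp

lemma eval_orbitPoly_map (g : M ≃ₐ[F] M) :
    ((orbitPoly E α).map (g : M →+* M)).eval α =
      ∏ h : E.fixingSubgroup, (α - g ((h : M ≃ₐ[F] M) α)) := by
  rw [orbitPoly_map, eval_prod]
  exact Finset.prod_congr rfl fun h _ => by simp

lemma orbitPoly_coeff_mem [IsGalois F M] (α : M) (i : ℕ) : (orbitPoly E α).coeff i ∈ E := by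
  suffices h : (orbitPoly E α).coeff i ∈ IntermediateField.fixedField E.fixingSubgroup by
    rwa [IsGalois.fixedField_fixingSubgroup] at h
  rintro ⟨g, hg⟩
  change g _ = _
  have h1 : (orbitPoly E α).map (g : M →+* M) = orbitPoly E α := by
    rw [orbitPoly_map, orbitPoly]
    exact Fintype.prod_equiv (Equiv.mulLeft (⟨g, hg⟩ : E.fixingSubgroup)) _ _ fun h => rfl
  conv_rhs => rw [← h1, coeff_map]
  rfl

include hinv hα in
lemma v_coeff_orbitPoly (i : ℕ) : 0 ≤ W.v ((orbitPoly E α).coeff i) := by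
  have := W.v_coeff_prod_X_sub_C (Finset.univ.val.map fun h : E.fixingSubgroup =>
    (h : M ≃ₐ[F] M) α) (fun x hx => by
      obtain ⟨h, -, rfl⟩ := Multiset.mem_map.mp hx
      rw [hinv]
      exact hα.nonneg) i
  rwa [Multiset.map_map] at this

include hinv hα in
lemma exists_eq_orbitPoly_mul {P : M[X]} (hP : ∀ i, 0 ≤ W.v (P.coeff i))
    (hroot : ∀ h : E.fixingSubgroup, P.eval ((h : M ≃ₐ[F] M) α) = 0) :
    ∃ Q : M[X], (∀ i, 0 ≤ W.v (Q.coeff i)) ∧ P = orbitPoly E α * Q := by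
  have hαh : ∀ h : E.fixingSubgroup, 0 ≤ W.v ((h : M ≃ₐ[F] M) α) := fun h => by
    rw [hinv]; exact hα.nonneg
  obtain ⟨p, hp⟩ : P ∈ lifts (algebraMap W.vr M) := by
    rw [lifts_iff_coeff_lifts]
    exact fun i => ⟨⟨_, hP i⟩, rfl⟩
  by_cases hp0 : p = 0
  · exact ⟨0, by simp [W.v_zero], by rw [← hp, hp0]; simp⟩
  let s : Multiset W.vr := Finset.univ.val.map fun h : E.fixingSubgroup => ⟨_, hαh h⟩
  have hs : s.Nodup := by
    refine Finset.univ.nodup.map fun g h hgh => ?_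
    exact Subtype.ext (eq_of_apply_eq hinv hα (congrArg Subtype.val hgh))
  have hle : s ≤ p.roots := by
    rw [Multiset.le_iff_subset hs]
    intro x hx
    obtain ⟨h, -, rfl⟩ := Multiset.mem_map.mp hx
    rw [mem_roots hp0, IsRoot.def]
    apply Subtype.val_injective
    have := hroot h
    rw [← hp, coe_mapRingHom, eval_map] at this
    exact (Polynomial.hom_eval₂ p (RingHom.id _) (algebraMap W.vr M) ⟨_, hαh h⟩).trans this
  obtain ⟨q, hq⟩ := (Multiset.prod_X_sub_C_dvd_iff_le_roots hp0 s).mpr hle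
  refine ⟨q.map (algebraMap W.vr M), fun i => ?_, ?_⟩
  · rw [coeff_map]
    exact (q.coeff i).2
  · rw [← hp]
    change p.map _ = _
    rw [hq, Polynomial.map_mul]
    congr 1
    rw [Multiset.map_map, orbitPoly]
    change (∏ h : E.fixingSubgroup, (X - C (⟨_, hαh h⟩ : W.vr))).map _ = _
    rw [Polynomial.map_prod]
    exact Finset.prod_congr rfl fun h _ => by simp

/-- The level of a coset is the level of the corresponding embedding. -/
theorem le_cosetLevel_iff [IsGalois F M] {c : WithTop ℝ} {g : M ≃ₐ[F] M} :
    c ≤ (galLevel hinv hα.nonneg).cosetLevel E.fixingSubgroup g ↔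
      ∀ x ∈ E, 0 ≤ W.v x → c ≤ W.v (g x - x) := by
  rw [cosetLevel_eq hinv hα, ← eval_orbitPoly_map]
  constructor
  · intro hc x hxE hx
    obtain ⟨P, hP, hPx⟩ := hα.exists_aeval x hx
    obtain ⟨Q, hQ, hPQ⟩ := exists_eq_orbitPoly_mul hinv hα E
      (P := P.map (algebraMap F M) - C x) (fun i => by
        rw [coeff_sub, coeff_map]
        refine W.le_v_sub (hP i) ?_
        rw [coeff_C]
        split_ifs
        · exact hx
        · rw [W.v_zero]; exact le_top) (fun h => by
        rw [eval_sub, eval_map_algebraMap, eval_C]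
        have h1 : (h : M ≃ₐ[F] M) (aeval α P) = aeval ((h : M ≃ₐ[F] M) α) P :=
          (aeval_algHom_apply (h : M ≃ₐ[F] M).toAlgHom α P).symm
        rw [← h1, hPx, sub_eq_zero]
        exact h.2 ⟨x, hxE⟩)
    have h2 := congrArg (fun R => (R.map (g : M →+* M)).eval α) hPQ
    simp only [Polynomial.map_sub, Polynomial.map_mul, Polynomial.map_map, map_C, eval_sub,
      eval_mul, eval_C] at h2
    have h3 : (g : M →+* M).comp (algebraMap F M) = algebraMap F M := by
      ext y; exact g.commutes y
    rw [h3, eval_map_algebraMap, hPx] at h2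
    change x - g x = _ at h2
    rw [W.v_sub_comm, h2, W.v_mul]
    refine hc.trans (le_add_of_nonneg_right (W.v_eval_nonneg (fun i => ?_) hα.nonneg))
    rw [coeff_map]
    exact (hQ i).trans_eq (hinv g _).symm
  · intro hc
    have h0 : (orbitPoly E α).eval α = 0 := by
      rw [orbitPoly, eval_prod]
      exact Finset.prod_eq_zero (Finset.mem_univ 1) (by simp)
    rw [← sub_zero (eval α _), ← h0, ← eval_sub]
    refine W.le_v_eval (fun i => ?_) hα.nonneg
    rw [coeff_sub, coeff_map]
    exact hc _ (orbitPoly_coeff_mem E α i) (v_coeff_orbitPoly hinv hα E i)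

end GaloisLevel
end AddVal

namespace AddVal
section GaloisCount

variable {F M : Type*} [Field F] [Field M] [Algebra F M] {W : AddVal M}
  [FiniteDimensional F M] [IsGalois F M] (E : IntermediateField F M)

omit [FiniteDimensional F M] [IsGalois F M] in
lemma IsInvariant.intermediateField (hinv : W.IsInvariant F) : W.IsInvariant E := fun g x =>
  hinv (g.restrictScalars F) x

omit [FiniteDimensional F M] in
lemma hasPerfectResidue_intermediateField (hinv : W.IsInvariant F)
    (hp : (W.comap (algebraMap F M)).HasPerfectResidue) :
    (W.comap (algebraMap E M)).HasPerfectResidue := by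
  refine HasPerfectResidue.of_comap (K := F) (fun x hx i => ?_) hp
  have := hinv.minpolyIntegral (algebraMap E M x) hx i
  rwa [minpoly.algebraMap_eq (algebraMap E M).injective] at this

variable (hinv : W.IsInvariant F) {α : M} (hα : W.IsIntegralGenerator F α) {eM : ℕ}

include hinv hα in
lemma card_fixingSubgroup_level (hp : (W.comap (algebraMap F M)).HasPerfectResidue)
    (hM : W.HasIdx eM) {eE : ℕ} (hE : (W.comap (algebraMap E M)).HasIdx eE) :
    Nat.card {h : E.fixingSubgroup // 0 < (galLevel hinv hα.nonneg).i h} * eE = eM := by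
  have hinvE := hinv.intermediateField E
  rw [← card_inertia (K := E) hinvE hinvE.minpolyIntegral
    (hasPerfectResidue_intermediateField E hinv hp) hE hM]
  congr 1
  refine Nat.card_congr ((IntermediateField.fixingSubgroupEquiv E).toEquiv.subtypeEquiv fun h => ?_)
  constructor
  · intro h0 x hx
    exact h0.trans_le ((le_galLevel_iff hinv hα).mp le_rfl x hx)
  · exact fun h0 => h0 α hα.nonneg

include hα in
omit [FiniteDimensional F M] [IsGalois F M] in
lemma cut_galLevel (hM : W.HasIdx eM) (g : M ≃ₐ[F] M) :
    cut ((galLevel hinv hα.nonneg).i g) (1 / eM) =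
      if 0 < (galLevel hinv hα.nonneg).i g then (1 / eM : ℝ) else 0 := by
  split_ifs with h
  · exact cut_of_le (hM.one_div_le h)
  · rw [← le_antisymm ((galLevel hinv hα.nonneg).nonneg g) (not_lt.mp h)]
    exact cut_zero_left (by positivity)

lemma subPhi_one_div (hp : (W.comap (algebraMap F M)).HasPerfectResidue)
    (hM : W.HasIdx eM) {eE : ℕ} (hE : (W.comap (algebraMap E M)).HasIdx eE) :
    (galLevel hinv hα.nonneg).subPhi E.fixingSubgroup (1 / eM) = 1 / eE := by
  have h1 := card_fixingSubgroup_level E hinv hα hp hM hE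
  rw [GroupLevel.subPhi, Finset.sum_congr rfl fun h _ => cut_galLevel hinv hα hM _,
    ← Finset.sum_filter, Finset.sum_const, nsmul_eq_mul]
  rw [Nat.card_eq_fintype_card, Fintype.card_subtype] at h1
  have h2 : (eM : ℝ) ≠ 0 := by exact_mod_cast hM.1.ne'
  have h3 : (eE : ℝ) ≠ 0 := by exact_mod_cast hE.1.ne'
  field_simp
  exact_mod_cast h1

variable (hn : (W.comap (algebraMap F M)).HasIdx 1)

include hn in
lemma quotPhi_one_div (hp : (W.comap (algebraMap F M)).HasPerfectResidue)
    (hM : W.HasIdx eM) {eE : ℕ} (hE : (W.comap (algebraMap E M)).HasIdx eE) :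
    (galLevel hinv hα.nonneg).quotPhi E.fixingSubgroup (1 / eE) = 1 := by
  have hbot : (W.comap (algebraMap (⊥ : IntermediateField F M) M)).HasIdx 1 := by
    refine ⟨hn.1, fun x hx => ?_, ?_⟩
    · obtain ⟨y, hy⟩ := IntermediateField.mem_bot.mp x.2
      obtain ⟨k, hk⟩ := hn.2.1 y (by rintro rfl; exact hx (Subtype.ext (by simpa using hy.symm)))
      refine ⟨k, ?_⟩
      rw [← hk]
      exact congrArg W.v hy.symm
    · obtain ⟨y, hy⟩ := hn.2.2
      exact ⟨⟨algebraMap F M y, IntermediateField.algebraMap_mem _ y⟩, hy⟩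
  have h1 := subPhi_one_div ⊥ hinv hα hp hM hbot
  rw [← subPhi_one_div E hinv hα hp hM hE, GroupLevel.quotPhi_subPhi]
  rw [GroupLevel.subPhi, IntermediateField.fixingSubgroup_bot] at h1
  rw [Nat.cast_one, div_one] at h1
  refine Eq.trans ?_ h1
  symm
  exact (Fintype.sum_equiv (Subgroup.topEquiv (G := M ≃ₐ[F] M)).toEquiv _ _ fun g => rfl)

lemma cut_cosetLevel_one_div (hp : (W.comap (algebraMap F M)).HasPerfectResidue)
    (hM : W.HasIdx eM) {eE : ℕ} (hE : (W.comap (algebraMap E M)).HasIdx eE) (g : M ≃ₐ[F] M) :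
    cut ((galLevel hinv hα.nonneg).cosetLevel E.fixingSubgroup g) (1 / eE) =
      if ((1 / eE : ℝ) : WithTop ℝ) ≤ (galLevel hinv hα.nonneg).cosetLevel E.fixingSubgroup g
        then (1 / eE : ℝ) else 0 := by
  split_ifs with h
  · exact cut_of_le h
  · rw [← subPhi_one_div E hinv hα hp hM hE, GroupLevel.subPhi_le_cosetLevel_iff] at h
    push Not at h
    rw [GroupLevel.cosetLevel, Finset.sum_eq_zero fun k _ => ?_]
    · exact cut_zero_left (by positivity)
    · by_contra h0
      exact absurd (hM.one_div_le (lt_of_le_of_ne ((galLevel hinv hα.nonneg).nonneg _)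
        (Ne.symm h0))) (not_le.mpr (h k))

include hn in
/-- The Herbrand function of `E`, computed in the Galois group of `M`. -/
theorem integral_card_level (hp : (W.comap (algebraMap F M)).HasPerfectResidue)
    (hM : W.HasIdx eM) {eE : ℕ} (hE : (W.comap (algebraMap E M)).HasIdx eE) {s : ℝ} (hs : 0 ≤ s)
    {n : ℝ → ℕ} {m : ℕ} (hm : m ≠ 0)
    (hn' : ∀ t, m * n t = (Finset.univ.filter fun g : M ≃ₐ[F] M => (((t + 1) / eE : ℝ) : WithTop ℝ) ≤
      (galLevel hinv hα.nonneg).cosetLevel E.fixingSubgroup g).card) :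
    ∫ t in (0 : ℝ)..s, ((n t : ℝ) / (n 0 : ℝ)) =
      (galLevel hinv hα.nonneg).quotPhi E.fixingSubgroup ((s + 1) / eE) - 1 := by
  set I := galLevel hinv hα.nonneg
  set H := E.fixingSubgroup
  have he : (0 : ℝ) < eE := by exact_mod_cast hE.1
  have hH : (0 : ℝ) < Fintype.card H := by exact_mod_cast Fintype.card_pos
  have hq := quotPhi_one_div E hinv hα hn hp hM hE
  have hm' : (m : ℝ) ≠ 0 := by exact_mod_cast hm
  have h0 : (m : ℝ) * n 0 = Fintype.card H * eE := by
    have h1 : ((m * n 0 : ℕ) : ℝ) = _ := congrArg Nat.cast (hn' 0)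
    rw [zero_add] at h1
    rw [GroupLevel.quotPhi, Finset.sum_congr rfl fun g _ =>
      cut_cosetLevel_one_div E hinv hα hp hM hE g, ← Finset.sum_filter, Finset.sum_const,
      nsmul_eq_mul, ← h1, div_eq_one_iff_eq hH.ne'] at hq
    push_cast at hq
    rw [← hq]
    field_simp
  have hsum : ∀ t : ℝ, (n t : ℝ) / n 0 = (∑ g : M ≃ₐ[F] M,
      if (((t + 1) / eE : ℝ) : WithTop ℝ) ≤ I.cosetLevel H g then (1 : ℝ) else 0) /
        (Fintype.card H * eE) := by
    intro t
    rw [← Finset.sum_filter, Finset.sum_const, nsmul_one, ← hn' t, ← h0]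
    push_cast
    rw [mul_div_mul_left _ _ hm']
  simp_rw [hsum]
  rw [intervalIntegral.integral_div, intervalIntegral.integral_finsetSum fun g _ =>
    (integral_indicator_cut _ he hs).1, Finset.sum_congr rfl fun g _ =>
    (integral_indicator_cut _ he hs).2, ← Finset.mul_sum, Finset.sum_sub_distrib,
    (div_eq_one_iff_eq hH.ne').mp hq, GroupLevel.quotPhi]
  field_simp

end GaloisCount
end AddVal

lemma card_mul_card_subtype_eq {G X : Type*} [Group G] (H : Subgroup G) {r : G → X}
    (hs : Function.Surjective r) (hr : ∀ g g', r g = r g' ↔ g⁻¹ * g' ∈ H) (P : X → Prop) :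
    Nat.card H * Nat.card {x // P x} = Nat.card {g // P (r g)} := by
  obtain ⟨s, hs⟩ := hs.hasRightInverse
  have hsh : ∀ (x : X) (h : H), r (s x * h) = x := fun x h => by
    conv_rhs => rw [← hs x]
    rw [eq_comm, hr, inv_mul_cancel_left]
    exact h.2
  rw [← Nat.card_prod]
  refine Nat.card_congr (Equiv.ofBijective
    (fun q => ⟨s q.2 * q.1, by rw [hsh]; exact q.2.2⟩) ⟨?_, ?_⟩)
  · rintro ⟨h, x, hx⟩ ⟨h', x', hx'⟩ heq
    have heq' := congrArg Subtype.val heq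
    change s x * h = s x' * h' at heq'
    have hxx : x = x' := by rw [← hsh x h, heq', hsh]
    subst hxx
    rw [mul_right_inj, ← Subtype.ext_iff] at heq'
    rw [heq']
  · rintro ⟨g, hg⟩
    refine ⟨⟨⟨(s (r g))⁻¹ * g, (hr _ _).mp (hs _)⟩, ⟨r g, hg⟩⟩, Subtype.ext ?_⟩
    exact mul_inv_cancel_left _ _

namespace IntermediateField

variable {F Ω : Type*} [Field F] [Field Ω] [Algebra F Ω]

lemma exists_algEquiv_extending [Normal F Ω] {E : IntermediateField F Ω} (σ : E →ₐ[F] Ω) :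
    ∃ δ : Ω ≃ₐ[F] Ω, ∀ x : E, δ x = σ x :=
  ⟨AlgEquiv.ofBijective (σ.liftNormal Ω) (AlgHom.normal_bijective F Ω Ω _),
    fun x => σ.liftNormal_commutes Ω x⟩

/-- The subgroup of the Galois group of `M` fixing a smaller field. -/
def fixer {E M : IntermediateField F Ω} (h : E ≤ M) : Subgroup (M ≃ₐ[F] M) :=
  (restrict h).fixingSubgroup

lemma mem_fixer {E M : IntermediateField F Ω} (h : E ≤ M) {g : M ≃ₐ[F] M} :
    g ∈ fixer h ↔ ∀ x : E, (g (inclusion h x) : Ω) = x := by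
  constructor
  · intro hg x
    exact congrArg Subtype.val (hg ⟨inclusion h x, (mem_restrict h _).mpr x.2⟩)
  · rintro hg ⟨x, hx⟩
    exact Subtype.ext (hg ⟨x, (mem_restrict h _).mp hx⟩)

/-- The embedding of a subfield of `M` induced by an automorphism of `M`. -/
def galEmb {E M : IntermediateField F Ω} (h : E ≤ M) (g : M ≃ₐ[F] M) : E →ₐ[F] Ω :=
  M.val.comp (g.toAlgHom.comp (inclusion h))

lemma galEmb_apply {E M : IntermediateField F Ω} (h : E ≤ M) (g : M ≃ₐ[F] M) (x : E) :
    galEmb h g x = g (inclusion h x) := rfl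

lemma galEmb_restrictNormal {E M : IntermediateField F Ω} (h : E ≤ M) [Normal F M]
    (γ : Ω ≃ₐ[F] Ω) : galEmb h (γ.restrictNormal M) = γ.toAlgHom.comp E.val := by
  ext x
  exact γ.restrictNormal_commutes M (inclusion h x)

lemma galEmb_surjective [Normal F Ω] {E M : IntermediateField F Ω} (h : E ≤ M) [Normal F M] :
    Function.Surjective (galEmb h) := by
  intro σ
  obtain ⟨δ, hδ⟩ := exists_algEquiv_extending σ
  refine ⟨δ.restrictNormal M, ?_⟩
  rw [galEmb_restrictNormal]
  ext x
  exact hδ x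

lemma galEmb_eq_iff {E M : IntermediateField F Ω} (h : E ≤ M) (g g' : M ≃ₐ[F] M) :
    galEmb h g = galEmb h g' ↔ g⁻¹ * g' ∈ fixer h := by
  rw [mem_fixer, AlgHom.ext_iff]
  refine forall_congr' fun x => ?_
  rw [galEmb_apply, galEmb_apply, AlgEquiv.mul_apply]
  constructor
  · intro hx
    rw [← Subtype.ext hx, ← AlgEquiv.mul_apply, inv_mul_cancel]
    rfl
  · intro hx
    have h1 : g⁻¹ (g' (inclusion h x)) = inclusion h x := Subtype.ext hx
    conv_lhs => rw [← h1, ← AlgEquiv.mul_apply, mul_inv_cancel]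
    rfl

end IntermediateField

namespace AddVal

variable {F Ω : Type*} [Field F] [Field Ω] [Algebra F Ω] {V : AddVal Ω}

lemma IsInvariant.exists_natDegree_mul [Normal F Ω] (hinv : V.IsInvariant F)
    (hnorm : V.IsNormalizedOn F) {x : Ω} (hx : x ≠ 0) :
    ∃ (a : ℝ) (k : ℤ), V.v x = (a : WithTop ℝ) ∧ (minpoly F x).natDegree * a = k := by
  have hint : IsIntegral F x := Algebra.IsIntegral.isIntegral x
  obtain ⟨a, ha⟩ := V.exists_real hx
  obtain ⟨k, hk⟩ := hnorm.1 _ (minpoly.coeff_zero_ne_zero hint hx)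
  refine ⟨a, k, ha, ?_⟩
  have hs := Normal.splits (inferInstance : Normal F Ω) x
  have hsplit := hs.eq_prod_roots_of_monic ((minpoly.monic hint).map _)
  have hgen : ∀ s : Multiset Ω, (∀ r ∈ s, V.v r = a) →
      V.v ((s.map fun r => Polynomial.X - Polynomial.C r).prod.coeff 0) =
        ((s.card * a : ℝ) : WithTop ℝ) := by
    intro s
    induction s using Multiset.induction_on with
    | empty => intro _; simp [V.v_one]
    | cons r s ih =>
      intro h
      rw [Multiset.map_cons, Multiset.prod_cons, Polynomial.mul_coeff_zero, V.v_mul,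
        ih fun t ht => h t (Multiset.mem_cons_of_mem ht)]
      have := h r (Multiset.mem_cons_self r s)
      simp only [Polynomial.coeff_sub, Polynomial.coeff_X_zero, Polynomial.coeff_C_zero, zero_sub,
        V.v_neg, this, Multiset.card_cons]
      rw [← WithTop.coe_add]
      congr 1
      push_cast
      ring
  have h1 := hgen _ (fun r hr => by
    have h1 : IsConjRoot F x r := (isConjRoot_iff_mem_minpoly_aroots hint).mpr hr
    obtain ⟨h, rfl⟩ := isConjRoot_iff_exists_algEquiv.mp h1.symm
    rw [hinv, ha])
  rw [← hsplit, Polynomial.coeff_map, hk, ← hs.natDegree_eq_card_roots,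
    Polynomial.natDegree_map] at h1
  exact_mod_cast h1.symm

lemma IsInvariant.exists_isRamIdx [Normal F Ω] (hinv : V.IsInvariant F)
    (hnorm : V.IsNormalizedOn F) (E : IntermediateField F Ω) [FiniteDimensional F E] :
    ∃ e, V.IsRamIdx E e := by
  have hn : 0 < Module.finrank F E := Module.finrank_pos
  set n := Module.finrank F E
  have hnR : (n : ℝ) ≠ 0 := by exact_mod_cast hn.ne'
  have key : ∀ x : E, x ≠ 0 → ∃ k : ℤ, V.v (x : Ω) = ((k / n : ℝ) : WithTop ℝ) := by
    intro x hx
    obtain ⟨a, k, ha, hk⟩ := hinv.exists_natDegree_mul hnorm (x := x) (by simpa using hx)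
    have hd : (minpoly F (x : Ω)).natDegree ∣ n := by
      have : minpoly F (x : Ω) = minpoly F x :=
        minpoly.algebraMap_eq (algebraMap E Ω).injective x
      rw [this]
      exact minpoly.degree_dvd (Algebra.IsIntegral.isIntegral x)
    obtain ⟨m, hm⟩ := hd
    refine ⟨k * m, ?_⟩
    rw [ha]
    congr 1
    rw [eq_div_iff hnR, hm]
    push_cast
    rw [← hk]
    ring
  let S : AddSubgroup ℤ :=
    { carrier := {k | ∃ x : E, V.v (x : Ω) = ((k / n : ℝ) : WithTop ℝ)}
      zero_mem' := ⟨1, by simp [V.v_one]⟩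
      add_mem' := by
        rintro j k ⟨x, hx⟩ ⟨y, hy⟩
        refine ⟨x * y, ?_⟩
        rw [MulMemClass.coe_mul, V.v_mul, hx, hy, ← WithTop.coe_add]
        congr 1
        push_cast
        ring
      neg_mem' := by
        rintro k ⟨x, hx⟩
        have hx0 : (x : Ω) ≠ 0 := by
          intro h
          rw [h, V.v_zero] at hx
          exact WithTop.top_ne_coe hx
        refine ⟨x⁻¹, ?_⟩
        have := V.v_inv_eq hx0 hx
        rw [IntermediateField.coe_inv, this]
        congr 1
        push_cast
        ring }
  have hnS : (n : ℤ) ∈ S := by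
    obtain ⟨x, hx⟩ := hnorm.2
    refine ⟨algebraMap F E x, ?_⟩
    push_cast
    rw [div_self hnR, ← hx]
  obtain ⟨a, ha⟩ := Int.subgroup_cyclic S
  rw [← AddSubgroup.zmultiples_eq_closure, ← Int.zmultiples_natAbs] at ha
  set g : ℕ := a.natAbs
  have hmem : ∀ k, k ∈ S ↔ (g : ℤ) ∣ k := fun k => by rw [ha, Int.mem_zmultiples_iff]
  obtain ⟨e, he⟩ : g ∣ n := by exact_mod_cast (hmem n).mp hnS
  have hg0 : (g : ℝ) ≠ 0 := by
    intro h
    have : g = 0 := by exact_mod_cast h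
    rw [he, this, zero_mul] at hn
    exact hn.ne rfl
  have he0 : 0 < e := by
    refine Nat.pos_of_ne_zero ?_
    rintro rfl
    rw [he, mul_zero] at hn
    exact hn.ne rfl
  have heR : (e : ℝ) ≠ 0 := by exact_mod_cast he0.ne'
  have hheR : (n : ℝ) = g * e := by exact_mod_cast he
  refine ⟨e, he0, fun x hx => ?_, ?_⟩
  · obtain ⟨k, hk⟩ := key x hx
    obtain ⟨j, rfl⟩ := (hmem k).mp ⟨x, hk⟩
    refine ⟨j, ?_⟩
    rw [hk, hheR]
    congr 1
    push_cast
    field_simp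
  · obtain ⟨x, hx⟩ := (hmem g).mpr dvd_rfl
    refine ⟨x, ?_⟩
    rw [hx, hheR]
    congr 1
    push_cast
    field_simp

end AddVal

namespace AddVal

open IntermediateField

variable {F Ω : Type*} [Field F] [Field Ω] [Algebra F Ω] {V : AddVal Ω}

/-- The level filtration of the Galois group of `M` describes the ramification relations and the
Herbrand functions of all subfields of `M`. -/
theorem exists_groupLevel [IsGalois F Ω] (hnorm : V.IsNormalizedOn F) (hhens : V.IsHenselianOn F)
    (hperf : V.HasPerfectResidueFieldOn F) {M : IntermediateField F Ω} [FiniteDimensional F M]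
    [IsGalois F M] {eM : ℕ} (hM : V.IsRamIdx M eM) :
    ∃ I : GroupLevel (M ≃ₐ[F] M), ∀ (E : IntermediateField F Ω) (h : E ≤ M) (eE : ℕ),
      V.IsRamIdx E eE →
      (∀ g t, xiRel V E eE t (galEmb h g) E.val ↔
        (((t + 1) / eE : ℝ) : WithTop ℝ) ≤ I.cosetLevel (fixer h) g) ∧
      ∀ s, 0 ≤ s → herbrand V E eE s = I.quotPhi (fixer h) ((s + 1) / eE) - 1 := by
  let W := V.comap (algebraMap M Ω)
  have hinv : W.IsInvariant F := fun g x => v_algEquiv_of_finite W hnorm hhens g x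
  have hn : (W.comap (algebraMap F M)).HasIdx 1 := by
    refine ⟨one_pos, fun x hx => ?_, ?_⟩
    · obtain ⟨k, hk⟩ := hnorm.1 x hx
      exact ⟨k, by rw [Nat.cast_one, div_one]; exact hk⟩
    · obtain ⟨x, hx⟩ := hnorm.2
      exact ⟨x, by rw [Nat.cast_one, div_one]; exact hx⟩
  have hp : (W.comap (algebraMap F M)).HasPerfectResidue := hperf
  have hMW : W.HasIdx eM := hM
  obtain ⟨α, hα0, hα⟩ := exists_generator hinv.minpolyIntegral hp hn hMW
  have hgen : W.IsIntegralGenerator F α := ⟨hα0, hα⟩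
  refine ⟨galLevel hinv hα0, fun E h eE hE => ?_⟩
  have hEW : (W.comap (algebraMap (restrict h) M)).HasIdx eE := by
    refine ⟨hE.1, fun x hx => ?_, ?_⟩
    · exact hE.2.1 ⟨x, (mem_restrict h _).mp x.2⟩
        fun h0 => hx (Subtype.ext (Subtype.ext (congrArg (fun y : E => (y : Ω)) h0)))
    · obtain ⟨x, hx⟩ := hE.2.2
      exact ⟨⟨inclusion h x, (mem_restrict h _).mpr x.2⟩, hx⟩
  have hrel : ∀ g t, xiRel V E eE t (galEmb h g) E.val ↔
      (((t + 1) / eE : ℝ) : WithTop ℝ) ≤ (galLevel hinv hα0).cosetLevel (fixer h) g := by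
    intro g t
    rw [fixer, le_cosetLevel_iff hinv hgen]
    constructor
    · exact fun H x hxE hx => H ⟨x, (mem_restrict h _).mp hxE⟩ hx
    · exact fun H x hx => H (inclusion h x) ((mem_restrict h _).mpr x.2) hx
  refine ⟨hrel, fun s hs => ?_⟩
  refine integral_card_level (restrict h) hinv hgen hn hp hMW hEW hs
    (m := Nat.card (fixer h)) Nat.card_pos.ne' fun t => ?_
  rw [gfun, card_mul_card_subtype_eq (fixer h) (galEmb_surjective h) (galEmb_eq_iff h),
    Nat.card_eq_fintype_card, Fintype.card_subtype]
  congr 1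
  ext g
  simp only [Finset.mem_filter, Finset.mem_univ, true_and]
  exact hrel g t

instance subsingleton_fixer (M : IntermediateField F Ω) : Subsingleton (fixer (le_refl M)) := by
  have h1 : ∀ g : fixer (le_refl M), g = 1 := by
    rintro ⟨g, hg⟩
    rw [mem_fixer] at hg
    ext x
    exact hg x
  exact ⟨fun g g' => (h1 g).trans (h1 g').symm⟩

lemma exists_finite_isGalois [IsGalois F Ω] (E : IntermediateField F Ω) [FiniteDimensional F E] :
    ∃ M : IntermediateField F Ω, E ≤ M ∧ FiniteDimensional F M ∧ IsGalois F M :=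
  ⟨normalClosure F E Ω, E.le_normalClosure, inferInstance, inferInstance⟩

theorem exists_herbrand_eq [IsGalois F Ω] (hnorm : V.IsNormalizedOn F)
    (hhens : V.IsHenselianOn F) (hperf : V.HasPerfectResidueFieldOn F)
    {E : IntermediateField F Ω} [FiniteDimensional F E] {e : ℕ} (he : V.IsRamIdx E e) {l : ℝ}
    (hl : 0 ≤ l) : ∃ s, 0 ≤ s ∧ herbrand V E e s = l := by
  obtain ⟨M, h, _, _⟩ := exists_finite_isGalois E
  have hinv : V.IsInvariant F := fun g x => V.v_algEquiv hnorm hhens g x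
  obtain ⟨eM, hM⟩ := hinv.exists_isRamIdx hnorm M
  obtain ⟨I, hI⟩ := exists_groupLevel hnorm hhens hperf hM
  obtain ⟨-, hE⟩ := hI E h e he
  have he0 : (0 : ℝ) < e := by exact_mod_cast he.1
  have hc : (0 : ℝ) < Fintype.card (fixer h) := by exact_mod_cast Fintype.card_pos
  have h0 : I.quotPhi (fixer h) ((0 + 1) / e) - 1 = 0 := by
    rw [← hE 0 le_rfl, herbrand, intervalIntegral.integral_same]
  set T := l * (e * Fintype.card (fixer h)) with hT
  have hT0 : 0 ≤ T := by positivity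
  have hTl : l ≤ I.quotPhi (fixer h) ((T + 1) / e) - 1 := by
    have := I.quotPhi_sub_ge (fixer h) (u := (0 + 1) / e) (u' := (T + 1) / e) (by gcongr)
    have h2 : ((T + 1) / e - (0 + 1) / e) / Fintype.card (fixer h) = l := by
      rw [hT]; field_simp; ring
    rw [h2] at this
    linarith
  have hcont : ContinuousOn (fun s : ℝ => I.quotPhi (fixer h) ((s + 1) / e) - 1) (Set.Icc 0 T) :=
    (((I.continuous_quotPhi (fixer h)).comp (by fun_prop)).sub continuous_const).continuousOn
  obtain ⟨s, hs, hsl⟩ := intermediate_value_Icc hT0 hcont ⟨h0.trans_le hl, hTl⟩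
  exact ⟨s, hs.1, by rw [hE s hs.1]; exact hsl⟩

/-- Herbrand's theorem: upper numbering is compatible with quotients. -/
theorem xiRel_galEmb_iff [IsGalois F Ω] (hnorm : V.IsNormalizedOn F)
    (hhens : V.IsHenselianOn F) (hperf : V.HasPerfectResidueFieldOn F)
    {E M : IntermediateField F Ω} [FiniteDimensional F M] [IsGalois F M] (h : E ≤ M)
    {eE eM : ℕ} (hE : V.IsRamIdx E eE) (hM : V.IsRamIdx M eM) {sE sM : ℝ} (hsE : 0 ≤ sE)
    (hsM : 0 ≤ sM) (hs : herbrand V E eE sE = herbrand V M eM sM) (g : M ≃ₐ[F] M) :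
    xiRel V E eE sE (galEmb h g) E.val ↔
      ∃ k ∈ fixer h, xiRel V M eM sM (galEmb le_rfl (g * k)) M.val := by
  obtain ⟨I, hI⟩ := exists_groupLevel hnorm hhens hperf hM
  obtain ⟨hE1, hE2⟩ := hI E h eE hE
  obtain ⟨hM1, hM2⟩ := hI M le_rfl eM hM
  have hcos : ∀ g, I.cosetLevel (fixer (le_refl M)) g = I.i g := by
    intro g
    rw [GroupLevel.cosetLevel, Fintype.sum_subsingleton _ 1]
    change I.i (g * 1) = _
    rw [mul_one]
  rw [hE2 _ hsE, hM2 _ hsM, sub_left_inj] at hs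
  have hq : ∀ u, I.quotPhi (fixer (le_refl M)) u = ∑ g, cut (I.i g) u := by
    intro u
    rw [← I.quotPhi_subPhi (fixer (le_refl M)) u, GroupLevel.subPhi,
      Fintype.sum_subsingleton _ 1]
    change _ = I.quotPhi _ (cut (I.i 1) u)
    rw [I.one, cut_top]
  rw [hq, ← I.quotPhi_subPhi (fixer h)] at hs
  rw [hE1, (I.quotPhi_strictMono (fixer h)).injective hs, I.subPhi_le_cosetLevel_iff]
  simp_rw [hM1, hcos]
  constructor
  · rintro ⟨k, hk⟩
    exact ⟨k, k.2, hk⟩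
  · rintro ⟨k, hk, h⟩
    exact ⟨⟨k, hk⟩, h⟩

end AddVal

namespace AddVal

open IntermediateField

variable {F Ω : Type*} [Field F] [Field Ω] [Algebra F Ω] {V : AddVal Ω}

lemma IsInvariant.xiRel_comp_iff (hinv : V.IsInvariant F) {E : IntermediateField F Ω} {e : ℕ}
    {s : ℝ} (δ : Ω ≃ₐ[F] Ω) {σ τ : E →ₐ[F] Ω} :
    xiRel V E e s (δ.toAlgHom.comp σ) (δ.toAlgHom.comp τ) ↔ xiRel V E e s σ τ := by
  refine forall_congr' fun x => forall_congr' fun _ => ?_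
  rw [← hinv δ (σ x - τ x), map_sub]
  rfl

lemma IsInvariant.inUpperRam_conj (hinv : V.IsInvariant F) {l : ℝ} {γ : Ω ≃ₐ[F] Ω}
    (hγ : inUpperRam V l γ) (δ : Ω ≃ₐ[F] Ω) : inUpperRam V l (δ⁻¹ * γ * δ) := by
  intro M eM sM hfin hgal hM hsM hs x hx
  have h1 := hγ M eM sM hfin hgal hM hsM hs (δ.restrictNormal M x)
    (by rw [AlgEquiv.restrictNormal_apply, hinv]; exact hx)
  change _ ≤ V.v (δ⁻¹ (γ (δ x)) - x)
  rw [← hinv δ, map_sub, ← AlgEquiv.mul_apply, mul_inv_cancel, AlgEquiv.one_apply]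
  change _ ≤ V.v (γ (δ.restrictNormal M x : Ω) - (δ.restrictNormal M x : Ω)) at h1
  rwa [AlgEquiv.restrictNormal_apply] at h1

variable [IsGalois F Ω] (hnorm : V.IsNormalizedOn F) (hhens : V.IsHenselianOn F)
  (hperf : V.HasPerfectResidueFieldOn F)

include hnorm hhens hperf

lemma xiRel_of_inUpperRam {l : ℝ} (hl : 0 ≤ l) {γ : Ω ≃ₐ[F] Ω} (hγ : inUpperRam V l γ)
    {E : IntermediateField F Ω} [FiniteDimensional F E] {e : ℕ} {s : ℝ} (he : V.IsRamIdx E e)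
    (hs : 0 ≤ s) (hsl : herbrand V E e s = l) : xiRel V E e s (γ.toAlgHom.comp E.val) E.val := by
  have hinv : V.IsInvariant F := fun g x => V.v_algEquiv hnorm hhens g x
  obtain ⟨M, h, hfin, hgal⟩ := exists_finite_isGalois E
  obtain ⟨eM, hM⟩ := hinv.exists_isRamIdx hnorm M
  obtain ⟨sM, hsM, hsMl⟩ := exists_herbrand_eq hnorm hhens hperf hM hl
  rw [← galEmb_restrictNormal h, xiRel_galEmb_iff hnorm hhens hperf h he hM hs hsM
    (hsl.trans hsMl.symm)]
  refine ⟨1, one_mem _, ?_⟩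
  rw [mul_one, galEmb_restrictNormal]
  exact hγ M eM sM hfin hgal hM hsM hsMl

/-- Elements of the upper ramification group restrict onto the ramification classes. -/
lemma exists_inUpperRam_of_xiRel {l : ℝ} (hl : 0 ≤ l) {E : IntermediateField F Ω}
    [FiniteDimensional F E] {e : ℕ} {s : ℝ} (he : V.IsRamIdx E e) (hs : 0 ≤ s)
    (hsl : herbrand V E e s = l) {σ : E →ₐ[F] Ω} (hσ : xiRel V E e s σ E.val) :
    ∃ γ : Ω ≃ₐ[F] Ω, inUpperRam V l γ ∧ γ.toAlgHom.comp E.val = σ := by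
  have hinv : V.IsInvariant F := fun g x => V.v_algEquiv hnorm hhens g x
  choose eN heN using fun N : FiniteGaloisIntermediateField F Ω =>
    hinv.exists_isRamIdx hnorm N.toIntermediateField
  choose sN hsN hsNl using fun N => exists_herbrand_eq hnorm hhens hperf (heN N) hl
  let J := {N : FiniteGaloisIntermediateField F Ω // E ≤ N.toIntermediateField}
  let C : J → Set (Ω ≃ₐ[F] Ω) := fun N =>
    AlgEquiv.restrictNormalHom N.1.toIntermediateField ⁻¹' {g | galEmb N.2 g = σ ∧
      xiRel V N.1.toIntermediateField (eN N.1) (sN N.1) (galEmb le_rfl g) (val _)}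
  have hC : ∀ N γ, γ ∈ C N ↔ γ.toAlgHom.comp E.val = σ ∧
      xiRel V N.1.toIntermediateField (eN N.1) (sN N.1)
        (γ.toAlgHom.comp (val _)) (val _) := by
    intro N γ
    rw [← galEmb_restrictNormal N.2, ← galEmb_restrictNormal (le_refl N.1.toIntermediateField)]
    rfl
  have hdown : ∀ (M : IntermediateField F Ω) (N : FiniteGaloisIntermediateField F Ω)
      (_ : M ≤ N.toIntermediateField) (eM : ℕ) (sM : ℝ) (γ : Ω ≃ₐ[F] Ω), V.IsRamIdx M eM →
      0 ≤ sM → herbrand V M eM sM = l →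
      xiRel V N.toIntermediateField (eN N) (sN N) (γ.toAlgHom.comp (val _)) (val _) →
      xiRel V M eM sM (γ.toAlgHom.comp M.val) M.val := by
    intro M N h eM sM γ hM hsM hsMl hγ
    rw [← galEmb_restrictNormal h, xiRel_galEmb_iff hnorm hhens hperf h hM (heN N) hsM (hsN N)
      (hsMl.trans (hsNl N).symm)]
    refine ⟨1, one_mem _, ?_⟩
    rwa [mul_one, galEmb_restrictNormal]
  have hclosed : ∀ N, IsClosed (C N) := fun N =>
    (isClosed_discrete _).preimage (InfiniteGalois.restrictNormalHom_continuous _)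
  have hne : ∀ N, (C N).Nonempty := by
    intro N
    obtain ⟨g, rfl⟩ := galEmb_surjective N.2 σ
    rw [xiRel_galEmb_iff hnorm hhens hperf N.2 he (heN N.1) hs (hsN N.1)
      (hsl.trans (hsNl N.1).symm)] at hσ
    obtain ⟨k, hk, hgk⟩ := hσ
    obtain ⟨γ, hγ⟩ := exists_algEquiv_extending
      (galEmb (le_refl N.1.toIntermediateField) (g * k))
    have hγ' : γ.toAlgHom.comp (val _) = galEmb (le_refl N.1.toIntermediateField) (g * k) :=
      AlgHom.ext hγ
    refine ⟨γ, (hC N γ).mpr ⟨?_, hγ' ▸ hgk⟩⟩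
    have h1 : galEmb N.2 g = galEmb N.2 (g * k) := by
      rwa [galEmb_eq_iff, inv_mul_cancel_left]
    rw [h1]
    ext x
    exact hγ (inclusion N.2 x)
  have hJ : Nonempty J :=
    let ⟨M, h, _, _⟩ := exists_finite_isGalois E
    ⟨⟨⟨M⟩, h⟩⟩
  have hdir : Directed (· ⊇ ·) C := by
    intro N N'
    refine ⟨⟨N.1 ⊔ N'.1, N.2.trans (le_sup_left (a := N.1) (b := N'.1))⟩, ?_, ?_⟩
    · intro γ hγ
      rw [hC] at hγ ⊢
      exact ⟨hγ.1, hdown _ _ (le_sup_left (a := N.1) (b := N'.1)) _ _ γ (heN _) (hsN _)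
        (hsNl _) hγ.2⟩
    · intro γ hγ
      rw [hC] at hγ ⊢
      exact ⟨hγ.1, hdown _ _ (le_sup_right (a := N.1) (b := N'.1)) _ _ γ (heN _) (hsN _)
        (hsNl _) hγ.2⟩
  obtain ⟨γ, hγ⟩ := IsCompact.nonempty_iInter_of_directed_nonempty_isCompact_isClosed C hdir hne
    (fun N => (hclosed N).isCompact) hclosed
  rw [Set.mem_iInter] at hγ
  obtain ⟨N₀⟩ := hJ
  refine ⟨γ, ?_, ((hC N₀ γ).mp (hγ N₀)).1⟩
  intro M eM sM hfin hgal hM hsM hsMl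
  let N : J := ⟨N₀.1 ⊔ ⟨M⟩, N₀.2.trans (le_sup_left (a := N₀.1) (b := ⟨M⟩))⟩
  exact hdown M N.1 (le_sup_right (a := N₀.1) (b := ⟨M⟩)) eM sM γ hM hsM hsMl
    ((hC N γ).mp (hγ N)).2

end AddVal

/-- For a separable algebraic extension `E/F` inside `F^sep` and a
nonnegative integer `l`: `E/F` is at most `l`-ramified (i.e. for every finite
subextension `E₀/F` the relation `Ξ^l = Ξ_{ψ_{E₀/F}(l)}` is the equality relation)
if and only if the upper ramification subgroup `I_F^l ⊆ Γ_F` fixes every `F`-algebra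
embedding `E ↪ F^sep`, i.e. `γ ∘ ι = ι` for all `γ ∈ I_F^l` and all `ι`. -/
theorem atMostRamified_iff_upperInertia_fixes_embeddings
    {F Ω : Type*} [Field F] [Field Ω] [Algebra F Ω] [IsSepClosure F Ω]
    (V : AddVal Ω) (hnorm : V.IsNormalizedOn F) (hhens : V.IsHenselianOn F)
    (hperf : V.HasPerfectResidueFieldOn F)
    (E : IntermediateField F Ω) (l : ℕ) :
    atMostRamified V E (l : ℝ) ↔
      ∀ γ : Ω ≃ₐ[F] Ω, inUpperRam V (l : ℝ) γ →
        ∀ ι : ↥E →ₐ[F] Ω, γ.toAlgHom.comp ι = ι := by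
  have : IsGalois F Ω := IsSepClosure.isGalois
  have hinv : V.IsInvariant F := fun g x => V.v_algEquiv hnorm hhens g x
  have hl : (0 : ℝ) ≤ l := Nat.cast_nonneg l
  constructor
  · intro hE γ hγ ι
    ext x
    have hle : IntermediateField.adjoin F {(x : Ω)} ≤ E :=
      IntermediateField.adjoin_simple_le_iff.mpr x.2
    have hfin : FiniteDimensional F (IntermediateField.adjoin F {(x : Ω)}) :=
      IntermediateField.adjoin.finiteDimensional (Algebra.IsIntegral.isIntegral _)
    obtain ⟨e, he⟩ := hinv.exists_isRamIdx hnorm (IntermediateField.adjoin F {(x : Ω)})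
    obtain ⟨s, hs, hsl⟩ := AddVal.exists_herbrand_eq hnorm hhens hperf he hl
    obtain ⟨δ, hδ⟩ := IntermediateField.exists_algEquiv_extending
      (ι.comp (IntermediateField.inclusion hle))
    have h1 := AddVal.xiRel_of_inUpperRam hnorm hhens hperf hl (hinv.inUpperRam_conj hγ δ)
      he hs hsl
    have h2 := DFunLike.congr_fun (hE _ hle hfin e s he hs hsl _ _ h1)
      (IntermediateField.AdjoinSimple.gen F (x : Ω))
    have h3 : δ x = ι x := hδ (IntermediateField.AdjoinSimple.gen F (x : Ω))
    change δ⁻¹ (γ (δ x)) = x at h2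
    rw [h3] at h2
    change γ (ι x) = ι x
    conv_rhs => rw [← h3, ← h2, ← AlgEquiv.mul_apply, mul_inv_cancel, AlgEquiv.one_apply]
  · intro hE E₀ hle hfin e s he hs hsl σ τ hστ
    obtain ⟨δ, hδ⟩ := IntermediateField.exists_algEquiv_extending τ
    have hτ : τ = δ.toAlgHom.comp E₀.val := AlgHom.ext fun x => (hδ x).symm
    have hσ : σ = δ.toAlgHom.comp (δ⁻¹.toAlgHom.comp σ) := by
      ext x
      change σ x = (δ * δ⁻¹) (σ x)
      rw [mul_inv_cancel, AlgEquiv.one_apply]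
    rw [hσ, hτ, hinv.xiRel_comp_iff] at hστ
    obtain ⟨γ, hγ, hγσ⟩ := AddVal.exists_inUpperRam_of_xiRel hnorm hhens hperf hl he hs hsl hστ
    have h1 := hE γ hγ E.val
    rw [hσ, hτ, ← hγσ]
    congr 1
    ext x
    exact DFunLike.congr_fun h1 (IntermediateField.inclusion hle x)
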